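/- arXiv:2412.17658 — 4 statements merged into one kernel-verified Lean document; each statement's English description precedes it below -/
import Mathlib

section
/- Let S, Z, U be random variables taking values in finite alphabets on a common probability space, and let ε ≥ 0. If the leakage constraint I(U;S) ≤ ε holds, then I(U;Z) ≤ H(Z|S) + ε. Consequently, the privacy-utility trade-off h_ε(P_{S,Z}) = sup_{P_{U|S,Z}: I(U;S) ≤ ε} I(U;Z) satisfies h_ε(P_{S,Z}) ≤ H(Z|S) + ε. (Upper bound of Theorem 1, with Z playing the role of the semantic f(X).) -/
open MeasureTheory ProbabilityTheory

/-- Shannon entropy (natural logarithm) of a random variable `X`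
taking values in a finite alphabet `α`. -/
noncomputable def infH {Ω : Type*} [MeasurableSpace Ω] {α : Type*} [Fintype α]
    (P : Measure Ω) (X : Ω → α) : ℝ :=
  ∑ a : α, Real.negMulLog (P (X ⁻¹' {a})).toReal

/-- Conditional Shannon entropy `H(X | Y)`. -/
noncomputable def infCondH {Ω : Type*} [MeasurableSpace Ω] {α β : Type*} [Fintype α] [Fintype β]
    (P : Measure Ω) (X : Ω → α) (Y : Ω → β) : ℝ :=
  infH P (fun ω => (X ω, Y ω)) - infH P Y

/-- Mutual information `I(X ; Y)`. -/
noncomputable def infMI {Ω : Type*} [MeasurableSpace Ω] {α β : Type*} [Fintype α] [Fintype β]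
    (P : Measure Ω) (X : Ω → α) (Y : Ω → β) : ℝ :=
  infH P X + infH P Y - infH P (fun ω => (X ω, Y ω))

/-- Conditional mutual information `I(X ; Y | Z)`. -/
noncomputable def infCMI {Ω : Type*} [MeasurableSpace Ω] {α β γ : Type*}
    [Fintype α] [Fintype β] [Fintype γ]
    (P : Measure Ω) (X : Ω → α) (Y : Ω → β) (Z : Ω → γ) : ℝ :=
  infCondH P X Z + infCondH P Y Z - infCondH P (fun ω => (X ω, Y ω)) Z

/-- The privacy–utility trade-off `h_ε(P_{S,Z})`: the supremum of `I(U;Z)` over all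
random variables `U` (with finite alphabet), defined on some probability space carrying a
copy of `(S,Z)` with joint distribution `μ`, subject to the leakage constraint `I(U;S) ≤ ε`. -/
noncomputable def hEps {σ ζ : Type} [Fintype σ] [MeasurableSpace σ] [MeasurableSingletonClass σ]
    [Fintype ζ] [MeasurableSpace ζ] [MeasurableSingletonClass ζ]
    (μ : Measure (σ × ζ)) (ε : ℝ) : ℝ :=
  sSup { r : ℝ | ∃ (Ω : Type) (_ : MeasurableSpace Ω) (P : Measure Ω)
    (_ : IsProbabilityMeasure P) (Sv : Ω → σ) (Zv : Ω → ζ) (n : ℕ) (U : Ω → Fin n),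
    Measurable Sv ∧ Measurable Zv ∧ Measurable U ∧
    P.map (fun ω => (Sv ω, Zv ω)) = μ ∧
    infMI P U Sv ≤ ε ∧ r = infMI P U Zv }

section Entropy

variable {Ω : Type*} [MeasurableSpace Ω] {P : Measure Ω}
  {α β γ : Type*}

lemma measureReal_eq_sum_inter_fiber [Fintype β] [MeasurableSpace β] [MeasurableSingletonClass β]
    [IsFiniteMeasure P] (A : Set Ω) {Y : Ω → β}
    (hY : Measurable Y) : P.real A = ∑ b, P.real (A ∩ Y ⁻¹' {b}) := by
  have h := sum_measureReal_preimage_singleton (μ := P.restrict A) (f := Y) Finset.univ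
    (fun b _ => hY (measurableSet_singleton b))
  simp only [Finset.coe_univ, Set.preimage_univ, measureReal_restrict_apply_univ] at h
  rw [← h]
  refine Finset.sum_congr rfl fun b _ => ?_
  rw [measureReal_restrict_apply (hY (measurableSet_singleton b)), Set.inter_comm]

lemma measureReal_fiber_eq_sum_right [Fintype β] [MeasurableSpace β] [MeasurableSingletonClass β]
    [IsFiniteMeasure P] (X : Ω → α) {Y : Ω → β}
    (hY : Measurable Y) (a : α) :
    P.real (X ⁻¹' {a}) = ∑ b, P.real ((fun ω => (X ω, Y ω)) ⁻¹' {(a, b)}) := by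
  rw [measureReal_eq_sum_inter_fiber _ hY]
  refine Finset.sum_congr rfl fun b _ => congrArg P.real ?_
  ext ω
  simp

lemma measureReal_fiber_eq_sum_left [Fintype α] [MeasurableSpace α] [MeasurableSingletonClass α]
    [IsFiniteMeasure P] {X : Ω → α} (Y : Ω → β)
    (hX : Measurable X) (b : β) :
    P.real (Y ⁻¹' {b}) = ∑ a, P.real ((fun ω => (X ω, Y ω)) ⁻¹' {(a, b)}) := by
  rw [measureReal_eq_sum_inter_fiber _ hX]
  refine Finset.sum_congr rfl fun a _ => congrArg P.real ?_
  ext ω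
  simp [and_comm]

lemma infH_eq_neg_sum [Fintype α] (P : Measure Ω) (X : Ω → α) :
    infH P X = -∑ a, P.real (X ⁻¹' {a}) * Real.log (P.real (X ⁻¹' {a})) := by
  simp [infH, Real.negMulLog, measureReal_def]

variable [Fintype α] [MeasurableSpace α] [MeasurableSingletonClass α] [Fintype β] [Fintype γ]

lemma infH_le_infH_prod [IsFiniteMeasure P] {X : Ω → α} (Y : Ω → β)
    (hX : Measurable X) : infH P Y ≤ infH P (fun ω => (X ω, Y ω)) := by
  rw [infH_eq_neg_sum, infH_eq_neg_sum, neg_le_neg_iff, Fintype.sum_prod_type_right]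
  refine Finset.sum_le_sum fun b _ => ?_
  conv_rhs => enter [1]; rw [measureReal_fiber_eq_sum_left Y hX b]
  rw [Finset.sum_mul]
  refine Finset.sum_le_sum fun a _ => ?_
  rcases (measureReal_nonneg (μ := P)
    (s := (fun ω => (X ω, Y ω)) ⁻¹' {(a, b)})).eq_or_lt with h | h
  · simp [← h]
  · refine mul_le_mul_of_nonneg_left (Real.log_le_log h (measureReal_mono ?_)) h.le
    rintro ω hω
    simp_all

lemma infCondH_nonneg [IsFiniteMeasure P] {X : Ω → α} (Y : Ω → β)
    (hX : Measurable X) : 0 ≤ infCondH P X Y :=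
  sub_nonneg.2 (infH_le_infH_prod Y hX)

lemma mul_log_add_sub_sub_le {p a b c : ℝ} (hp : 0 ≤ p) (hpa : p ≤ a) (hpb : p ≤ b)
    (hpc : p ≤ c) :
    p * Real.log a + p * Real.log b - p * Real.log c - p * Real.log p ≤ a * b / c - p := by
  rcases hp.eq_or_lt with rfl | h
  · simpa using div_nonneg (mul_nonneg hpa hpb) hpc
  · have ha := h.trans_le hpa
    have hb := h.trans_le hpb
    have hc := h.trans_le hpc
    have hlog := Real.log_le_sub_one_of_pos (show 0 < a * b / (c * p) by positivity)
    rw [Real.log_div (by positivity) (by positivity), Real.log_mul ha.ne' hb.ne',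
      Real.log_mul hc.ne' h.ne'] at hlog
    have := mul_le_mul_of_nonneg_left hlog hp
    have e : p * (a * b / (c * p) - 1) = a * b / c - p := by field_simp
    linarith

variable [MeasurableSpace β] [MeasurableSingletonClass β]

lemma infH_submodular [IsFiniteMeasure P] {X : Ω → α} {Y : Ω → β} {Z : Ω → γ}
    (hX : Measurable X) (hY : Measurable Y) :
    infH P (fun ω => (Z ω, (X ω, Y ω))) + infH P Z ≤
      infH P (fun ω => (X ω, Z ω)) + infH P (fun ω => (Z ω, Y ω)) := by
  set p : γ → α → β → ℝ := fun z x y =>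
    P.real ((fun ω => (Z ω, (X ω, Y ω))) ⁻¹' {(z, (x, y))}) with hp
  set a : γ → α → ℝ := fun z x => P.real ((fun ω => (X ω, Z ω)) ⁻¹' {(x, z)}) with ha
  set b : γ → β → ℝ := fun z y => P.real ((fun ω => (Z ω, Y ω)) ⁻¹' {(z, y)}) with hb
  set c : γ → ℝ := fun z => P.real (Z ⁻¹' {z}) with hc
  have hac (z : γ) : c z = ∑ x, a z x := measureReal_fiber_eq_sum_left Z hX z
  have hbc (z : γ) : c z = ∑ y, b z y := measureReal_fiber_eq_sum_right Z hY z
  have hpa (z : γ) (x : α) : a z x = ∑ y, p z x y := by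
    simp only [ha, hp]
    rw [measureReal_eq_sum_inter_fiber _ hY]
    refine Finset.sum_congr rfl fun y _ => congrArg P.real ?_
    ext ω
    simp only [Set.mem_inter_iff, Set.mem_preimage, Set.mem_singleton_iff, Prod.mk.injEq]
    tauto
  have hpb (z : γ) (y : β) : b z y = ∑ x, p z x y := by
    simp only [hb, hp]
    rw [measureReal_eq_sum_inter_fiber _ hX]
    refine Finset.sum_congr rfl fun x _ => congrArg P.real ?_
    ext ω
    simp only [Set.mem_inter_iff, Set.mem_preimage, Set.mem_singleton_iff, Prod.mk.injEq]
    tauto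
  have hp0 (z : γ) (x : α) (y : β) : 0 ≤ p z x y := measureReal_nonneg
  have ha0 (z : γ) (x : α) : 0 ≤ a z x := measureReal_nonneg
  have hle_a (z : γ) (x : α) (y : β) : p z x y ≤ a z x := by
    rw [hpa]
    exact Finset.single_le_sum (f := fun y => p z x y) (fun y _ => hp0 z x y) (Finset.mem_univ y)
  have hle_b (z : γ) (x : α) (y : β) : p z x y ≤ b z y := by
    rw [hpb]
    exact Finset.single_le_sum (f := fun x => p z x y) (fun x _ => hp0 z x y) (Finset.mem_univ x)
  have hle_c (z : γ) (x : α) (y : β) : p z x y ≤ c z := by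
    refine (hle_a z x y).trans ?_
    rw [hac]
    exact Finset.single_le_sum (fun x _ => ha0 z x) (Finset.mem_univ x)
  have key : ∀ z, ∑ x, a z x * Real.log (a z x) + ∑ y, b z y * Real.log (b z y)
      - c z * Real.log (c z) - ∑ x, ∑ y, p z x y * Real.log (p z x y) ≤ 0 := by
    intro z
    have h := Finset.sum_le_sum fun x (_ : x ∈ Finset.univ) =>
      Finset.sum_le_sum fun y (_ : y ∈ Finset.univ) =>
        mul_log_add_sub_sub_le (hp0 z x y) (hle_a z x y) (hle_b z x y) (hle_c z x y)
    have hab : ∑ x, ∑ y, a z x * b z y / c z = c z := by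
      simp_rw [← Finset.sum_div, ← Finset.mul_sum, ← hbc, ← Finset.sum_mul, ← hac]
      exact mul_self_div_self (c z)
    have hpc : ∑ x, ∑ y, p z x y = c z := by simp_rw [← hpa, ← hac]
    have hA : ∑ x, ∑ y, p z x y * Real.log (a z x) = ∑ x, a z x * Real.log (a z x) := by
      simp_rw [← Finset.sum_mul, ← hpa]
    have hB : ∑ x, ∑ y, p z x y * Real.log (b z y) = ∑ y, b z y * Real.log (b z y) := by
      rw [Finset.sum_comm]
      simp_rw [← Finset.sum_mul, ← hpb]
    have hC : ∑ x, ∑ y, p z x y * Real.log (c z) = c z * Real.log (c z) := by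
      simp_rw [← Finset.sum_mul, hpc]
    simp only [Finset.sum_sub_distrib, Finset.sum_add_distrib, hab, hpc, hA, hB, hC] at h
    linarith
  have total := Finset.sum_nonpos fun z (_ : z ∈ Finset.univ) => key z
  simp only [Finset.sum_sub_distrib, Finset.sum_add_distrib] at total
  simp only [infH_eq_neg_sum]
  rw [Fintype.sum_prod_type, Fintype.sum_prod_type_right, Fintype.sum_prod_type]
  simp only [Fintype.sum_prod_type]
  linarith

variable [MeasurableSpace γ] [MeasurableSingletonClass γ]

lemma infMI_le_infCondH_add_infMI [IsFiniteMeasure P] {X : Ω → α} {Y : Ω → β} {Z : Ω → γ}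
    (hX : Measurable X) (hY : Measurable Y) (hZ : Measurable Z) :
    infMI P X Z ≤ infCondH P Z Y + infMI P X Y := by
  have h₁ := infH_submodular (P := P) (Z := Z) hX hY
  have h₂ := infH_le_infH_prod (P := P) (fun ω => (X ω, Y ω)) hZ
  unfold infMI infCondH
  linarith

lemma infH_congr_of_map_eq {Ω' : Type*} [MeasurableSpace Ω'] {P' : Measure Ω'}
    {X : Ω → α} {X' : Ω' → α} (hX : Measurable X) (hX' : Measurable X')
    (h : P.map X = P'.map X') : infH P X = infH P' X' := by
  refine Finset.sum_congr rfl fun a _ => ?_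
  rw [← Measure.map_apply hX (measurableSet_singleton a), h,
    Measure.map_apply hX' (measurableSet_singleton a)]

lemma infCondH_congr_of_map_eq {Ω' : Type*} [MeasurableSpace Ω'] {P' : Measure Ω'}
    {X : Ω → α} {Y : Ω → β} {X' : Ω' → α} {Y' : Ω' → β}
    (hX : Measurable X) (hY : Measurable Y) (hX' : Measurable X') (hY' : Measurable Y')
    (h : P.map (fun ω => (Y ω, X ω)) = P'.map (fun ω => (Y' ω, X' ω))) :
    infCondH P X Y = infCondH P' X' Y' := by
  refine congrArg₂ (· - ·) (infH_congr_of_map_eq (hX.prodMk hY) (hX'.prodMk hY') ?_)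
    (infH_congr_of_map_eq hY hY' ?_)
  · have := congrArg (Measure.map Prod.swap) h
    rwa [Measure.map_map measurable_swap (hY.prodMk hX),
      Measure.map_map measurable_swap (hY'.prodMk hX')] at this
  · have := congrArg (Measure.map Prod.fst) h
    rwa [Measure.map_map measurable_fst (hY.prodMk hX),
      Measure.map_map measurable_fst (hY'.prodMk hX')] at this

end Entropy

/-- If `S, Z, U` are random variables on a common probability space with
finite alphabets and the leakage constraint `I(U;S) ≤ ε` holds (`ε ≥ 0`), then
`I(U;Z) ≤ H(Z|S) + ε`.  Consequently the privacy–utility trade-off satisfies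
`h_ε(P_{S,Z}) ≤ H(Z|S) + ε`. -/
theorem upper_bound_tradeoff
    {Ω : Type} [MeasurableSpace Ω] (P : Measure Ω) [IsProbabilityMeasure P]
    {σ ζ υ : Type} [Fintype σ] [MeasurableSpace σ] [MeasurableSingletonClass σ]
    [Fintype ζ] [MeasurableSpace ζ] [MeasurableSingletonClass ζ]
    [Fintype υ] [MeasurableSpace υ] [MeasurableSingletonClass υ]
    (S : Ω → σ) (Z : Ω → ζ) (U : Ω → υ)
    (hS : Measurable S) (hZ : Measurable Z) (hU : Measurable U)
    {ε : ℝ} (hε : 0 ≤ ε) (hleak : infMI P U S ≤ ε) :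
    infMI P U Z ≤ infCondH P Z S + ε ∧
    hEps (P.map (fun ω => (S ω, Z ω))) ε ≤ infCondH P Z S + ε := by
  refine ⟨(infMI_le_infCondH_add_infMI hU hS hZ).trans (by gcongr), ?_⟩
  refine Real.sSup_le ?_ (add_nonneg (infCondH_nonneg S hZ) hε)
  rintro r ⟨Ω', _, P', _, S', Z', n, U', hS', hZ', hU', hmap, hleak', rfl⟩
  rw [infCondH_congr_of_map_eq hZ hS hZ' hS' hmap.symm]
  exact (infMI_le_infCondH_add_infMI hU' hS' hZ').trans (by gcongr)
end

section
/- (Extended Functional Representation Lemma) Let S and Z be random variables on finite alphabets with joint distribution P_{S,Z}, and let ε satisfy 0 ≤ ε ≤ H(S). Then there exists a random variable U, jointly distributed with (S,Z), such that I(U;S) = ε and H(Z|S,U) = 0. -/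
open MeasureTheory ProbabilityTheory

/-- Entropy only depends on the laws of the variables. -/
theorem infH_congr {Ω Ω' α : Type*} [MeasurableSpace Ω] [MeasurableSpace Ω'] [Fintype α]
    {P : Measure Ω} {Q : Measure Ω'} {X : Ω → α} {Y : Ω' → α}
    (h : ∀ a, P (X ⁻¹' {a}) = Q (Y ⁻¹' {a})) : infH P X = infH Q Y := by
  simp only [infH, h]

/-- Entropy is invariant under injective relabelling. -/
theorem infH_comp_injective {Ω α β : Type*} [MeasurableSpace Ω] [Fintype α] [Fintype β]
    (P : Measure Ω) (X : Ω → α) {e : α → β} (he : Function.Injective e) :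
    infH P (fun ω => e (X ω)) = infH P X := by
  symm
  refine Fintype.sum_of_injective e he _ _ (fun b hb => ?_) (fun a => ?_)
  · have : (fun ω => e (X ω)) ⁻¹' {b} = ∅ := by
      ext ω
      simpa using fun h => hb ⟨X ω, h⟩
    simp [this]
  · congr 3
    ext ω
    simp [he.eq_iff]

theorem sum_measureReal_singleton_eq_one {α : Type*} [Fintype α] [MeasurableSpace α]
    [MeasurableSingletonClass α] (P : Measure α) [IsProbabilityMeasure P] :
    ∑ a, (P {a}).toReal = 1 := by
  rw [← ENNReal.toReal_sum (fun a _ => measure_ne_top P _)]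
  simp [sum_measure_singleton]

theorem sum_toReal_measure_preimage_eq_one {Ω α : Type*} [Fintype α] [MeasurableSpace Ω]
    [DiscreteMeasurableSpace Ω] (P : Measure Ω) [IsProbabilityMeasure P] (X : Ω → α) :
    ∑ a, (P (X ⁻¹' {a})).toReal = 1 := by
  rw [← ENNReal.toReal_sum (fun a _ => measure_ne_top P _),
    sum_measure_preimage_singleton _ (fun _ _ => .of_discrete)]
  simp

/-- Entropy is additive over independent variables. -/
theorem infH_prod {Ω Ω' α β : Type*} [MeasurableSpace Ω] [MeasurableSpace Ω']
    [DiscreteMeasurableSpace Ω] [DiscreteMeasurableSpace Ω'] [Fintype α] [Fintype β]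
    (P : Measure Ω) (Q : Measure Ω') [IsProbabilityMeasure P] [IsProbabilityMeasure Q]
    (X : Ω → α) (Y : Ω' → β) :
    infH (P.prod Q) (fun ω => (X ω.1, Y ω.2)) = infH P X + infH Q Y := by
  have h (a : α) (b : β) : (P.prod Q) ((fun ω => (X ω.1, Y ω.2)) ⁻¹' {(a, b)}) =
      P (X ⁻¹' {a}) * Q (Y ⁻¹' {b}) := by
    rw [← Measure.prod_prod]
    congr 1
    ext ω
    simp
  simp only [infH, Fintype.sum_prod_type, h, ENNReal.toReal_mul, Real.negMulLog_mul,
    Finset.sum_add_distrib, ← Finset.mul_sum, ← Finset.sum_mul,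
    sum_toReal_measure_preimage_eq_one, one_mul]

/-- The law of a coin showing `true` with probability `t`. -/
noncomputable def coinMeasure (t : ℝ) : Measure Bool :=
  ENNReal.ofReal t • Measure.dirac true + ENNReal.ofReal (1 - t) • Measure.dirac false

theorem coinMeasure_true (t : ℝ) : coinMeasure t {true} = ENNReal.ofReal t := by
  simp [coinMeasure]

theorem coinMeasure_false (t : ℝ) : coinMeasure t {false} = ENNReal.ofReal (1 - t) := by
  simp [coinMeasure]

theorem isProbabilityMeasure_coinMeasure {t : ℝ} (h0 : 0 ≤ t) (h1 : t ≤ 1) :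
    IsProbabilityMeasure (coinMeasure t) := by
  constructor
  simp [coinMeasure, ← ENNReal.ofReal_add h0 (sub_nonneg.2 h1)]

/-- The output of an erasure channel: the input is revealed when the coin shows `true`. -/
def erasure {σ : Type*} (x : σ × Bool) : Option σ :=
  if x.2 then some x.1 else none

/-- Through an erasure channel revealing its input with probability `t`, the mutual information
between output and input is `t` times the entropy of the input. -/
theorem infMI_erasure {σ : Type*} [Fintype σ] [MeasurableSpace σ] [MeasurableSingletonClass σ]
    (ν : Measure σ) [IsProbabilityMeasure ν] {t : ℝ} (h0 : 0 ≤ t) (h1 : t ≤ 1) :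
    infMI (ν.prod (coinMeasure t)) erasure Prod.fst = t * infH ν id := by
  have := isProbabilityMeasure_coinMeasure h0 h1
  have hS : infH (ν.prod (coinMeasure t)) Prod.fst = infH ν id := by
    refine infH_congr fun s => ?_
    rw [← Set.prod_univ, Measure.prod_prod, measure_univ, mul_one, Set.preimage_id]
  have hpair : infH (ν.prod (coinMeasure t)) (fun x => (erasure x, x.1)) =
      infH ν id + infH (coinMeasure t) id := by
    have he : Function.Injective fun x : σ × Bool => (erasure x, x.1) := by
      rintro ⟨s, b⟩ ⟨s', b'⟩ h
      cases b <;> cases b' <;> simp_all [erasure]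
    rw [← infH_prod ν (coinMeasure t) id id]
    exact infH_comp_injective (ν.prod (coinMeasure t)) (fun x => (id x.1, id x.2)) he
  have hnone : (ν.prod (coinMeasure t)) (erasure ⁻¹' {none}) = ENNReal.ofReal (1 - t) := by
    have : (erasure ⁻¹' {none} : Set (σ × Bool)) = Set.univ ×ˢ {false} := by
      ext ⟨s, b⟩
      simp [erasure]
    rw [this, Measure.prod_prod, coinMeasure_false, measure_univ, one_mul]
  have hsome (s : σ) : (ν.prod (coinMeasure t)) (erasure ⁻¹' {some s}) =
      ν {s} * ENNReal.ofReal t := by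
    rw [← coinMeasure_true, ← Measure.prod_prod]
    congr 1
    ext ⟨s', b⟩
    cases b <;> simp [erasure]
  simp only [infMI, hS, hpair]
  simp only [infH, Fintype.sum_option, hnone, hsome, ENNReal.toReal_mul, Real.negMulLog_mul,
    Finset.sum_add_distrib, ← Finset.mul_sum, ← Finset.sum_mul, Fintype.sum_bool,
    Set.preimage_id, coinMeasure_true, coinMeasure_false, ENNReal.toReal_ofReal h0,
    ENNReal.toReal_ofReal (sub_nonneg.2 h1), sum_measureReal_singleton_eq_one]
  ring

/-- Evaluating an independent random function with marginals `μ.condKernel s` at the first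
marginal of `μ` recovers `μ`. -/
theorem prod_pi_condKernel_eval {σ ζ : Type*} [Fintype σ] [MeasurableSpace σ]
    [MeasurableSingletonClass σ] [Fintype ζ] [MeasurableSpace ζ] [MeasurableSingletonClass ζ]
    [Nonempty ζ] (μ : Measure (σ × ζ)) [IsProbabilityMeasure μ] (s : σ) (z : ζ) :
    μ.fst {s} * (Measure.pi fun s => μ.condKernel s) {f | f s = z} = μ {(s, z)} := by
  have h1 : (Measure.pi fun s => μ.condKernel s) {f | f s = z} = μ.condKernel s {z} :=
    (measurePreserving_eval (fun s => μ.condKernel s) s).measure_preimage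
      (measurableSet_singleton z).nullMeasurableSet
  rw [h1, mul_comm, ← Set.singleton_prod_singleton]
  conv_rhs => rw [← μ.disintegrate μ.condKernel]
  rw [Measure.compProd_apply_prod (measurableSet_singleton s) (measurableSet_singleton z),
    lintegral_singleton]

/-- **Extended Functional Representation Lemma.** Let `S` and `Z` be random
variables on finite alphabets with joint distribution `μ = P_{S,Z}`, and let `0 ≤ ε ≤ H(S)`.
Then there exists a random variable `U` (on a probability space carrying a copy of `(S,Z)`
with the given joint distribution) such that `I(U;S) = ε` and `H(Z|S,U) = 0`. -/
theorem extended_functional_representation_lemma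
    {σ ζ : Type} [Fintype σ] [MeasurableSpace σ] [MeasurableSingletonClass σ]
    [Fintype ζ] [MeasurableSpace ζ] [MeasurableSingletonClass ζ]
    (μ : Measure (σ × ζ)) [IsProbabilityMeasure μ]
    {ε : ℝ} (hε : 0 ≤ ε) (hεH : ε ≤ infH μ Prod.fst) :
    ∃ (Ω : Type) (_ : MeasurableSpace Ω) (P : Measure Ω) (_ : IsProbabilityMeasure P)
      (Sv : Ω → σ) (Zv : Ω → ζ) (n : ℕ) (U : Ω → Fin n),
      Measurable Sv ∧ Measurable Zv ∧ Measurable U ∧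
      P.map (fun ω => (Sv ω, Zv ω)) = μ ∧
      infMI P U Sv = ε ∧
      infCondH P Zv (fun ω => (Sv ω, U ω)) = 0 := by
  classical
  have hne : Nonempty ζ := (nonempty_of_isProbabilityMeasure μ).map Prod.snd
  obtain ⟨t, h0, h1, ht⟩ : ∃ t : ℝ, 0 ≤ t ∧ t ≤ 1 ∧ t * infH μ Prod.fst = ε := by
    rcases eq_or_ne (infH μ Prod.fst) 0 with h | h
    · exact ⟨0, le_rfl, zero_le_one, by linarith⟩
    · exact ⟨ε / infH μ Prod.fst, div_nonneg hε (hε.trans hεH),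
        div_le_one_of_le₀ hεH (hε.trans hεH), div_mul_cancel₀ _ h⟩
  have := isProbabilityMeasure_coinMeasure h0 h1
  set ρ := μ.fst.prod (coinMeasure t)
  set π := Measure.pi fun s => μ.condKernel s
  have hfst : infH μ.fst id = infH μ Prod.fst :=
    infH_congr fun s => Measure.fst_apply (measurableSet_singleton s)
  let e := Fintype.equivFin (Option σ × (σ → ζ))
  refine ⟨(σ × Bool) × (σ → ζ), inferInstance, ρ.prod π, inferInstance,
    fun ω => ω.1.1, fun ω => ω.2 ω.1.1, _, fun ω => e (erasure ω.1, ω.2),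
    .of_discrete, .of_discrete, .of_discrete, ?_, ?_, ?_⟩
  · refine Measure.ext_of_singleton fun ⟨s, z⟩ => ?_
    rw [Measure.map_apply .of_discrete (measurableSet_singleton _), ← prod_pi_condKernel_eval]
    have hset : (fun ω : (σ × Bool) × (σ → ζ) => (ω.1.1, ω.2 ω.1.1)) ⁻¹' {(s, z)} =
        ({s} ×ˢ Set.univ) ×ˢ {f | f s = z} := by
      ext ⟨⟨s', b⟩, f⟩
      simp only [Set.mem_preimage, Set.mem_singleton_iff, Prod.mk.injEq, Set.mem_prod,
        Set.mem_univ, and_true, Set.mem_ofPred_eq]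
      exact and_congr_right fun h => by rw [h]
    rw [hset, Measure.prod_prod, Measure.prod_prod, measure_univ, mul_one]
  · have hU : infH (ρ.prod π) (fun ω => e (erasure ω.1, ω.2)) = infH ρ erasure + infH π id := by
      rw [infH_comp_injective _ _ e.injective]
      exact infH_prod ρ π erasure id
    have hS : infH (ρ.prod π) (fun ω => ω.1.1) = infH ρ Prod.fst := by
      refine infH_congr fun s => ?_
      have : (fun ω : (σ × Bool) × (σ → ζ) => ω.1.1) ⁻¹' {s} =
          (Prod.fst ⁻¹' {s}) ×ˢ Set.univ := by
        ext ω
        simp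
      rw [this, Measure.prod_prod, measure_univ, mul_one]
    have hUS : infH (ρ.prod π) (fun ω => (e (erasure ω.1, ω.2), ω.1.1)) =
        infH ρ (fun x => (erasure x, x.1)) + infH π id := by
      have he : Function.Injective fun x : (Option σ × σ) × (σ → ζ) =>
          (e (x.1.1, x.2), x.1.2) := by
        rintro ⟨⟨a, b⟩, c⟩ ⟨⟨a', b'⟩, c'⟩ h
        simp_all
      rw [← infH_prod ρ π (fun x => (erasure x, x.1)) id]
      exact infH_comp_injective (ρ.prod π) (fun ω => ((erasure ω.1, ω.1.1), id ω.2)) he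
    have hW := infMI_erasure μ.fst h0 h1
    rw [hfst, ht] at hW
    rw [← hW]
    simp only [infMI, hU, hS, hUS, ρ]
    ring
  · have he : Function.Injective
        fun x : σ × Fin (Fintype.card (Option σ × (σ → ζ))) => ((e.symm x.2).2 x.1, x) :=
      fun x y h => (Prod.mk.inj h).2
    have h := infH_comp_injective (ρ.prod π) (fun ω => (ω.1.1, e (erasure ω.1, ω.2))) he
    simp only [Equiv.symm_apply_apply] at h
    exact sub_eq_zero.2 h
end

section
/- Let S and Z be random variables on finite alphabets with joint distribution P_{S,Z}, H(S) > 0, and let ε satisfy 0 ≤ ε ≤ H(S); set α = ε/H(S). Then there exists a random variable U, jointly distributed with (S,Z), such that I(U;S) = ε and I(U;Z) ≥ H(Z|S) − α·H(S|Z) + ε − (1−α)·(log(I(S;Z) + 1) + 4). In particular, h_ε(P_{S,Z}) ≥ L_h^2(ε) := H(Z|S) − α·H(S|Z) + ε − (1−α)·(log(I(S;Z)+1) + 4). (Second lower bound of Theorem 1, with Z playing the role of the semantic f(X).) -/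
open MeasureTheory ProbabilityTheory

section ExponentialRace

open Set Real

/-- The law of a standard exponential random variable. -/
noncomputable def stdExp : Measure ℝ :=
  (volume.restrict (Ioi 0)).withDensity fun x => ENNReal.ofReal (exp (-x))

lemma lintegral_stdExp {g : ℝ → ENNReal} (hg : Measurable g) :
    ∫⁻ x, g x ∂stdExp = ∫⁻ x in Ioi 0, ENNReal.ofReal (exp (-x)) * g x := by
  rw [stdExp, lintegral_withDensity_eq_lintegral_mul _ (by fun_prop) hg]
  rfl

lemma stdExp_Ioi {c : ℝ} (hc : 0 ≤ c) : stdExp (Ioi c) = ENNReal.ofReal (exp (-c)) := by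
  rw [stdExp, withDensity_apply _ measurableSet_Ioi, Measure.restrict_restrict measurableSet_Ioi,
    inter_eq_left.2 (Ioi_subset_Ioi hc), ← integral_exp_neg_Ioi,
    ofReal_integral_eq_lintegral_ofReal ?_]
  · exact ae_of_all _ fun x => (exp_pos _).le
  · simpa [IntegrableOn] using integrableOn_exp_mul_Ioi neg_one_lt_zero c

instance : IsProbabilityMeasure stdExp := by
  constructor
  rw [← lintegral_one, lintegral_stdExp measurable_const]
  have := stdExp_Ioi le_rfl
  rw [stdExp, withDensity_apply _ measurableSet_Ioi, Measure.restrict_restrict measurableSet_Ioi,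
    inter_self] at this
  simpa using this

lemma ae_stdExp_pos : ∀ᵐ x ∂stdExp, 0 < x :=
  (withDensity_absolutelyContinuous _ _).ae_le (ae_restrict_mem measurableSet_Ioi)

lemma integral_id_mul_exp_neg {r : ℝ} (hr : 0 < r) :
    ∫ t in Ioi 0, t * exp (-(r * t)) = (1 / r) ^ 2 := by
  have := integral_rpow_mul_exp_neg_mul_Ioi (a := 2) two_pos hr
  norm_num at this
  simpa using this

lemma integrableOn_id_mul_exp_neg {r : ℝ} (hr : 0 < r) :
    IntegrableOn (fun t => t * exp (-(r * t))) (Ioi 0) :=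
  Integrable.of_integral_ne_zero (by rw [integral_id_mul_exp_neg hr]; positivity)

lemma lintegral_exp_neg_div {p : ℝ} (hp : 0 < p) :
    ∫⁻ x in Ioi 0, ENNReal.ofReal (exp (-(x / p))) = ENNReal.ofReal p := by
  have e : ∀ x : ℝ, -(x / p) = -p⁻¹ * x := fun x => by ring
  have hn : -p⁻¹ < 0 := by simpa using hp
  simp_rw [e]
  rw [← ofReal_integral_eq_lintegral_ofReal (integrableOn_exp_mul_Ioi hn 0)
    (ae_of_all _ fun x => (exp_pos _).le), integral_exp_mul_Ioi hn]
  congr 1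
  simp

lemma lintegral_id_mul_exp_neg_div {p : ℝ} (hp : 0 < p) :
    ∫⁻ x in Ioi 0, ENNReal.ofReal x * ENNReal.ofReal (exp (-(x / p))) =
      ENNReal.ofReal (p ^ 2) := by
  have hp' : 0 < p⁻¹ := by positivity
  have h := integral_id_mul_exp_neg hp'
  rw [one_div, inv_inv] at h
  rw [← h, ofReal_integral_eq_lintegral_ofReal (integrableOn_id_mul_exp_neg hp')]
  · refine setLIntegral_congr_fun measurableSet_Ioi fun x hx => ?_
    rw [← ENNReal.ofReal_mul (le_of_lt hx), div_eq_inv_mul]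
  · filter_upwards [ae_restrict_mem measurableSet_Ioi] with x hx
    exact mul_nonneg (le_of_lt hx) (exp_pos _).le

/-- The event that, among independent exponential clocks `e` with rates `p`, the clock `z` rings
first; the ringing times are `e z / p z`. -/
def raceWon {ζ : Type*} (p : ζ → ℝ) (z : ζ) : Set (ζ → ℝ) :=
  {e | ∀ i, i ≠ z → e z * p i < e i * p z}

lemma measurableSet_raceWon {ζ : Type*} [Fintype ζ] (p : ζ → ℝ) (z : ζ) :
    MeasurableSet (raceWon p z) := by
  simp only [raceWon, ofPred_forall]
  refine MeasurableSet.iInter fun i => MeasurableSet.iInter fun _ => ?_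
  exact measurableSet_lt (by fun_prop) (by fun_prop)

variable {ζ : Type*} [Fintype ζ]

/-- The law of independent standard exponential variables. -/
noncomputable abbrev expProd (ζ : Type*) [Fintype ζ] : Measure (ζ → ℝ) :=
  Measure.pi fun _ => stdExp

lemma ae_expProd_pos (z : ζ) : ∀ᵐ e ∂(expProd ζ), 0 < e z :=
  (measurePreserving_eval (fun _ : ζ => stdExp) z).quasiMeasurePreserving.ae ae_stdExp_pos

open Classical in
lemma setLIntegral_raceWon {p : ζ → ℝ} (hp : ∀ z, 0 ≤ p z) (hp1 : ∑ z, p z = 1) {z : ζ}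
    (hz : 0 < p z) {g : ℝ → ENNReal} (hg : Measurable g) :
    ∫⁻ e in raceWon p z, g (e z) ∂(expProd ζ) =
      ∫⁻ x in Ioi 0, g x * ENNReal.ofReal (exp (-(x / p z))) := by
  obtain ⟨Q, hQ⟩ : ∃ Q : ζ → Prop, ∀ i, Q i ↔ i = z := ⟨fun i => i = z, fun _ => Iff.rfl⟩
  let z₀ : {i // Q i} := ⟨z, (hQ z).2 rfl⟩
  let T : Set (({i // Q i} → ℝ) × ({i // ¬ Q i} → ℝ)) :=
    {ab | ∀ i : {i // ¬ Q i}, ab.1 z₀ * p i / p z < ab.2 i}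
  have hT : MeasurableSet T := by
    simp only [T, ofPred_forall]
    refine MeasurableSet.iInter fun i => measurableSet_lt (by fun_prop) (by fun_prop)
  let G : (({i // Q i} → ℝ) × ({i // ¬ Q i} → ℝ)) → ENNReal :=
    T.indicator fun ab => g (ab.1 z₀)
  have hG : Measurable G := Measurable.indicator (by fun_prop) hT
  have hmp := measurePreserving_piEquivPiSubtypeProd (fun _ : ζ => stdExp) Q
  have h1 : ∫⁻ e in raceWon p z, g (e z) ∂(expProd ζ) =
      ∫⁻ e, G (MeasurableEquiv.piEquivPiSubtypeProd (fun _ : ζ => ℝ) Q e) ∂(expProd ζ) := by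
    rw [← lintegral_indicator (measurableSet_raceWon p z)]
    refine lintegral_congr fun e => ?_
    have hiff : e ∈ raceWon p z ↔
        MeasurableEquiv.piEquivPiSubtypeProd (fun _ : ζ => ℝ) Q e ∈ T := by
      simp only [raceWon, T, mem_ofPred_eq, div_lt_iff₀ hz, Subtype.forall, hQ]
      rfl
    by_cases h : e ∈ raceWon p z
    · rw [indicator_of_mem h, show G _ = _ from indicator_of_mem (hiff.1 h) _]
      rfl
    · rw [indicator_of_notMem h, show G _ = _ from indicator_of_notMem (mt hiff.2 h) _]
  have h2 : ∀ x : ℝ, 0 < x →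
      ∏ i : {i // ¬ Q i}, stdExp (Ioi (x * p i / p z)) =
        ENNReal.ofReal (exp (-(x * (1 - p z) / p z))) := by
    intro x hx
    have : ∀ i : {i // ¬ Q i}, stdExp (Ioi (x * p i / p z)) =
        ENNReal.ofReal (exp (-(x * p i / p z))) := fun i =>
      stdExp_Ioi (div_nonneg (mul_nonneg hx.le (hp i)) hz.le)
    simp_rw [this]
    rw [← ENNReal.ofReal_prod_of_nonneg (fun _ _ => (exp_pos _).le), ← exp_sum]
    congr 2
    have hs : ∑ i : {i // ¬ Q i}, p i = 1 - p z := by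
      rw [← hp1, ← Fintype.sum_subtype_add_sum_subtype Q p,
        Fintype.sum_eq_single z₀ fun i hi => absurd (Subtype.ext ((hQ i).1 i.2)) hi]
      simp [z₀]
    rw [← hs, Finset.mul_sum, Finset.sum_div, Finset.sum_neg_distrib]
  have h3 : ∀ a : {i // Q i} → ℝ, 0 < a z₀ →
      ∫⁻ b, G (a, b) ∂(Measure.pi fun _ : {i // ¬ Q i} => stdExp) =
        g (a z₀) * ENNReal.ofReal (exp (-(a z₀ * (1 - p z) / p z))) := by
    intro a ha
    have : ∀ b, G (a, b) =
        (univ.pi fun i : {i // ¬ Q i} => Ioi (a z₀ * p i / p z)).indicator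
          (fun _ => g (a z₀)) b := by
      intro b
      simp only [G, indicator]
      refine if_congr ?_ rfl rfl
      simp [T]
    simp_rw [this]
    rw [lintegral_indicator_const (MeasurableSet.univ_pi fun _ => measurableSet_Ioi),
      Measure.pi_pi, h2 _ ha]
  have hev := measurePreserving_eval (fun _ : {i // Q i} => stdExp) z₀
  have hE : Measurable fun x : ℝ => g x * ENNReal.ofReal (exp (-(x * (1 - p z) / p z))) := by
    fun_prop
  rw [h1, hmp.lintegral_comp hG, lintegral_prod _ hG.aemeasurable,
    lintegral_congr_ae (g := fun a => g (a z₀) * ENNReal.ofReal (exp (-(a z₀ * (1 - p z) / p z))))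
      ((hev.quasiMeasurePreserving.ae ae_stdExp_pos).mono h3),
    hev.lintegral_comp hE, lintegral_stdExp hE]
  refine lintegral_congr fun x => ?_
  rw [mul_left_comm, ← ENNReal.ofReal_mul (exp_pos _).le, ← exp_add]
  congr 4
  field_simp
  ring

lemma expProd_raceWon {p : ζ → ℝ} (hp : ∀ z, 0 ≤ p z) (hp1 : ∑ z, p z = 1) {z : ζ}
    (hz : 0 < p z) : expProd ζ (raceWon p z) = ENNReal.ofReal (p z) := by
  have := setLIntegral_raceWon hp hp1 hz (g := fun _ => 1) measurable_const
  simpa [lintegral_exp_neg_div hz] using this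

lemma setLIntegral_clock_raceWon {p : ζ → ℝ} (hp : ∀ z, 0 ≤ p z) (hp1 : ∑ z, p z = 1) {z : ζ}
    (hz : 0 < p z) :
    ∫⁻ e in raceWon p z, ENNReal.ofReal (e z) ∂(expProd ζ) = ENNReal.ofReal (p z ^ 2) := by
  rw [setLIntegral_raceWon hp hp1 hz ENNReal.measurable_ofReal, lintegral_id_mul_exp_neg_div hz]

/-- The winner of an exponential race with rates `p` has law `p`; on the event that `z` wins, the
rescaled ringing time `e z` has integral `p z ^ 2`. -/
lemma exists_race_winner [MeasurableSpace ζ] [MeasurableSingletonClass ζ]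
    {p : ζ → ℝ} (hp : ∀ z, 0 ≤ p z) (hp1 : ∑ z, p z = 1) :
    ∃ Y : (ζ → ℝ) → ζ, Measurable Y ∧ ∀ z, (expProd ζ).real (Y ⁻¹' {z}) = p z ∧
      IntegrableOn (fun e => e z) (Y ⁻¹' {z}) (expProd ζ) ∧
      ∫ e in Y ⁻¹' {z}, e z ∂(expProd ζ) = p z ^ 2 := by
  have : Nonempty ζ := by
    by_contra h
    rw [not_nonempty_iff] at h
    simp at hp1
  obtain ⟨Y, hY, hYw⟩ := exists_measurable_piecewise (raceWon p) (measurableSet_raceWon p)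
    (fun z _ => z) (fun _ => measurable_const) (by
      intro i j hij e he
      exact absurd (he.1 j hij.symm) (he.2 i hij).not_gt)
  have hsub : ∀ z, raceWon p z ⊆ Y ⁻¹' {z} := fun z e he => hYw z he
  have hge : ∀ z, p z ≤ (expProd ζ).real (Y ⁻¹' {z}) := by
    intro z
    rcases (hp z).eq_or_lt with h | h
    · rw [← h]
      exact measureReal_nonneg
    · calc p z = (expProd ζ).real (raceWon p z) := by
            rw [measureReal_def, expProd_raceWon hp hp1 h, ENNReal.toReal_ofReal h.le]
        _ ≤ _ := measureReal_mono (hsub z)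
  have hsum : ∑ z, (expProd ζ).real (Y ⁻¹' {z}) = 1 := by
    rw [sum_measureReal_preimage_singleton _ fun z _ => hY (measurableSet_singleton z)]
    simp
  have heq : ∀ z, (expProd ζ).real (Y ⁻¹' {z}) = p z := fun z =>
    ((Finset.sum_eq_sum_iff_of_le fun z _ => hge z).1 (hp1.trans hsum.symm) z
      (Finset.mem_univ z)).symm
  refine ⟨Y, hY, fun z => ⟨heq z, ?_⟩⟩
  rcases (hp z).eq_or_lt with h | h
  · have h0 : expProd ζ (Y ⁻¹' {z}) = 0 := by
      rw [← measureReal_eq_zero_iff, heq z, h]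
    rw [IntegrableOn, Measure.restrict_eq_zero.2 h0, ← h]
    simp
  · have hae : raceWon p z =ᵐ[expProd ζ] Y ⁻¹' {z} := by
      refine ae_eq_of_subset_of_measure_ge (hsub z) ?_
        (measurableSet_raceWon p z).nullMeasurableSet (measure_ne_top _ _)
      rw [expProd_raceWon hp hp1 h, ← heq z, measureReal_def,
        ENNReal.ofReal_toReal (measure_ne_top _ _)]
    have hpos : 0 ≤ᵐ[(expProd ζ).restrict (raceWon p z)] fun e => e z :=
      (ae_restrict_of_ae (ae_expProd_pos z)).mono fun e he => le_of_lt he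
    have hI : IntegrableOn (fun e => e z) (raceWon p z) (expProd ζ) := by
      refine ⟨(measurable_pi_apply z).aestronglyMeasurable, ?_⟩
      rw [hasFiniteIntegral_iff_ofReal hpos, setLIntegral_clock_raceWon hp hp1 h]
      exact ENNReal.ofReal_lt_top
    refine ⟨hI.congr_set_ae hae.symm, ?_⟩
    rw [← setIntegral_congr_set hae, integral_eq_lintegral_of_nonneg_ae hpos
        (measurable_pi_apply z).aestronglyMeasurable,
      setLIntegral_clock_raceWon hp hp1 h, ENNReal.toReal_ofReal (by positivity)]

lemma integrableOn_and_integral_rpow_damping {δ q : ℝ} (hδ : 0 < δ) (hq : 0 < q) :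
    IntegrableOn (fun x => δ * (1 + x / q) ^ (-(1 + δ))) (Ioi 0) ∧
      ∫ x in Ioi 0, δ * (1 + x / q) ^ (-(1 + δ)) = q := by
  have hd : ∀ x ∈ Ici (0 : ℝ), HasDerivAt (fun x => -q * (1 + x / q) ^ (-δ))
      (δ * (1 + x / q) ^ (-(1 + δ))) x := by
    intro x hx
    have hx' : 0 < 1 + x / q := by
      have : 0 ≤ x / q := div_nonneg hx hq.le
      linarith
    have h1 : HasDerivAt (fun x => 1 + x / q) (1 / q) x :=
      ((hasDerivAt_id x).div_const q).const_add 1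
    refine ((h1.rpow_const (p := -δ) (Or.inl hx'.ne')).const_mul (-q)).congr_deriv ?_
    rw [show -δ - 1 = -(1 + δ) by ring]
    field_simp
  have hpos : ∀ x ∈ Ioi (0 : ℝ), 0 ≤ δ * (1 + x / q) ^ (-(1 + δ)) := by
    intro x hx
    have : 0 < x := hx
    positivity
  have hlim : Filter.Tendsto (fun x => -q * (1 + x / q) ^ (-δ)) Filter.atTop (nhds (-q * 0)) :=
    ((tendsto_rpow_neg_atTop hδ).comp (Filter.tendsto_atTop_add_const_left _ _
      (Filter.tendsto_id.atTop_div_const hq))).const_mul _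
  refine ⟨integrableOn_Ioi_deriv_of_nonneg' hd hpos hlim, ?_⟩
  rw [integral_Ioi_of_hasDerivAt_of_nonneg' hd hpos hlim]
  simp

lemma integrable_and_integral_damping_le {δ q : ℝ} (hδ : 0 < δ) (hq : 0 < q) :
    Integrable (fun x => δ * (1 + x / q) ^ (-(1 + δ))) stdExp ∧
      ∫ x, δ * (1 + x / q) ^ (-(1 + δ)) ∂stdExp ≤ q := by
  obtain ⟨hI, hq'⟩ := integrableOn_and_integral_rpow_damping hδ hq
  have hm : Measurable fun x : ℝ => δ * (1 + x / q) ^ (-(1 + δ)) := by fun_prop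
  have hpos : 0 ≤ᵐ[stdExp] fun x => δ * (1 + x / q) ^ (-(1 + δ)) :=
    ae_stdExp_pos.mono fun x hx => by
      dsimp
      positivity
  have hle : ∫⁻ x, ENNReal.ofReal (δ * (1 + x / q) ^ (-(1 + δ))) ∂stdExp ≤ ENNReal.ofReal q := by
    rw [lintegral_stdExp (by fun_prop)]
    calc _ ≤ ∫⁻ x in Ioi 0, ENNReal.ofReal (δ * (1 + x / q) ^ (-(1 + δ))) := by
          refine setLIntegral_mono (by fun_prop) fun x hx => ?_
          refine mul_le_of_le_one_left zero_le ?_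
          rw [ENNReal.ofReal_le_one, exp_le_one_iff, neg_nonpos]
          exact le_of_lt hx
      _ = ENNReal.ofReal q := by
          rw [← ofReal_integral_eq_lintegral_ofReal hI, hq']
          filter_upwards [ae_restrict_mem measurableSet_Ioi] with x hx
          have : 0 < x := hx
          dsimp
          positivity
  refine ⟨⟨hm.aestronglyMeasurable, ?_⟩, ?_⟩
  · rw [hasFiniteIntegral_iff_ofReal hpos]
    exact hle.trans_lt ENNReal.ofReal_lt_top
  · rw [integral_eq_lintegral_of_nonneg_ae hpos hm.aestronglyMeasurable]
    exact ENNReal.toReal_le_of_le_ofReal hq.le hle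

end ExponentialRace

section FunctionalRepresentation

open Real

lemma negMulLog_le_mul_add_exp_neg {a : ℝ} (ha : 0 ≤ a) (L : ℝ) :
    negMulLog a ≤ a * L + exp (-L) - a := by
  rcases ha.eq_or_lt with rfl | ha
  · simpa using (exp_pos (-L)).le
  · have h := log_le_sub_one_of_pos (div_pos (exp_pos (-L)) ha)
    rw [log_div (exp_pos _).ne' ha.ne', log_exp] at h
    have h' := mul_le_mul_of_nonneg_left h ha.le
    have e : a * (exp (-L) / a - 1) = exp (-L) - a := by field_simp
    rw [negMulLog]
    linarith

lemma log_one_add_div_le_tangent {x p q : ℝ} (hx : 0 ≤ x) (hp : 0 ≤ p) (hq : 0 < q) :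
    log (1 + x / q) ≤ log (1 + p / q) + (x - p) / (q + p) := by
  have hx' : 0 < 1 + x / q := by positivity
  have hp' : 0 < 1 + p / q := by positivity
  have h := log_le_sub_one_of_pos (div_pos hx' hp')
  rw [log_div hx'.ne' hp'.ne'] at h
  have e : (1 + x / q) / (1 + p / q) - 1 = (x - p) / (q + p) := by
    field_simp
    ring
  linarith

lemma mul_log_one_add_div_le {c p q : ℝ} (hc : 0 ≤ c) (hp : 0 ≤ p) (hq : 0 ≤ q)
    (h0 : q = 0 → c * p = 0) :
    c * p * log (1 + p / q) ≤ c * p * log (p / q) + c * q := by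
  rcases hq.eq_or_lt with rfl | hq
  · simp
  rcases hp.eq_or_lt with rfl | hp
  · simpa using mul_nonneg hc hq.le
  have e : 1 + p / q = p / q * (1 + q / p) := by field_simp; ring
  have h : log (1 + q / p) ≤ q / p := by
    have := log_le_sub_one_of_pos (show 0 < 1 + q / p by positivity)
    linarith
  rw [e, log_mul (by positivity) (by positivity)]
  have h2 : c * p * log (1 + q / p) ≤ c * p * (q / p) := by gcongr
  have e2 : c * p * (q / p) = c * q := by field_simp
  linarith

lemma sub_le_mul_log_div {c p q : ℝ} (hc : 0 ≤ c) (hp : 0 ≤ p) (hq : 0 ≤ q)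
    (h0 : q = 0 → c * p = 0) : c * p - c * q ≤ c * p * log (p / q) := by
  rcases hq.eq_or_lt with rfl | hq
  · simp [h0 rfl]
  rcases hp.eq_or_lt with rfl | hp
  · simpa using mul_nonneg hc hq.le
  have h := log_le_sub_one_of_pos (div_pos hq hp)
  rw [← inv_div, log_inv] at h
  have h' := mul_le_mul_of_nonneg_left h (mul_nonneg hc hp.le)
  have e : c * p * ((p / q)⁻¹ - 1) = c * q - c * p := by field_simp
  linarith

variable {σ ζ : Type*} [Fintype σ] [Fintype ζ] [DecidableEq ζ]

/-- A vector `Y` of race winners, all driven by the same clocks: the mean of the contribution of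
the letter `z` to the entropy of the law of `Y · e` under `P`. -/
lemma integral_negMulLog_race_le [MeasurableSpace ζ] [MeasurableSingletonClass ζ]
    {P : σ → ℝ} (hP0 : ∀ s, 0 ≤ P s) {z : ζ} {p : σ → ℝ} (hp0 : ∀ s, 0 ≤ p s)
    (hq : 0 < ∑ s, P s * p s) {Y : σ → (ζ → ℝ) → ζ} (hYm : ∀ s, Measurable (Y s))
    (hY : ∀ s, (expProd ζ).real (Y s ⁻¹' {z}) = p s ∧
      IntegrableOn (fun e => e z) (Y s ⁻¹' {z}) (expProd ζ) ∧
      ∫ e in Y s ⁻¹' {z}, e z ∂(expProd ζ) = p s ^ 2)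
    (hint : Integrable (fun e => negMulLog (∑ s, if Y s e = z then P s else 0)) (expProd ζ))
    {δ : ℝ} (hδ : 0 < δ) :
    ∫ e, negMulLog (∑ s, if Y s e = z then P s else 0) ∂(expProd ζ) ≤
      ∑ s, P s * p s * ((1 + δ) * log (1 + p s / ∑ s, P s * p s) - log δ) := by
  set q := ∑ s, P s * p s with hqdef
  let f : ℝ → ℝ := fun x => δ * (1 + x / q) ^ (-(1 + δ))
  obtain ⟨hfI, hfq⟩ := integrable_and_integral_damping_le hδ hq
  have hev := measurePreserving_eval (fun _ : ζ => stdExp) z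
  have hfI' : Integrable (fun e : ζ → ℝ => f (e z)) (expProd ζ) :=
    hev.integrable_comp_of_integrable hfI
  have hfq' : ∫ e, f (e z) ∂(expProd ζ) ≤ q := by
    rw [← hev.map_eq, integral_map hev.measurable.aemeasurable
      (by rw [hev.map_eq]; exact hfI.aestronglyMeasurable)] at hfq
    exact hfq
  let c : σ → ℝ := fun s => (1 + δ) * log (1 + p s / q) - log δ - 1
  let d : σ → ℝ := fun s => (1 + δ) / (q + p s)
  let R : σ → (ζ → ℝ) → ℝ := fun s =>
    (Y s ⁻¹' {z}).indicator fun e => c s + d s * (e z - p s)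
  have hms : ∀ s, MeasurableSet (Y s ⁻¹' {z}) := fun s => hYm s (measurableSet_singleton z)
  have hRon : ∀ s, IntegrableOn (fun e => d s * (e z - p s)) (Y s ⁻¹' {z}) (expProd ζ) :=
    fun s => ((hY s).2.1.sub (integrable_const _)).const_mul _
  have hRI : ∀ s, Integrable (R s) (expProd ζ) := fun s =>
    (integrable_indicator_iff (hms s)).2 ((integrable_const _).add (hRon s))
  have hRint : ∀ s, ∫ e, R s e ∂(expProd ζ) = c s * p s := by
    intro s
    rw [integral_indicator (hms s), integral_add (integrable_const _) (hRon s), integral_const_mul,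
      integral_sub (hY s).2.1 (integrable_const _), (hY s).2.2, setIntegral_const, setIntegral_const,
      (hY s).1, smul_eq_mul, smul_eq_mul]
    ring
  have hpt : ∀ᵐ e ∂(expProd ζ), negMulLog (∑ s, if Y s e = z then P s else 0) ≤
      ∑ s, P s * R s e + f (e z) := by
    filter_upwards [ae_expProd_pos z] with e he
    have hb : 0 < 1 + e z / q := by positivity
    have ha : 0 ≤ ∑ s, if Y s e = z then P s else 0 :=
      Finset.sum_nonneg fun s _ => by split_ifs <;> simp [hP0]
    refine (negMulLog_le_mul_add_exp_neg ha ((1 + δ) * log (1 + e z / q) - log δ)).trans ?_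
    have hexp : exp (-((1 + δ) * log (1 + e z / q) - log δ)) = f (e z) := by
      rw [show -((1 + δ) * log (1 + e z / q) - log δ) =
        log δ + log (1 + e z / q) * (-(1 + δ)) by ring, exp_add, exp_log hδ, ← rpow_def_of_pos hb]
    have hR : (∑ s, if Y s e = z then P s else 0) * ((1 + δ) * log (1 + e z / q) - log δ) -
        (∑ s, if Y s e = z then P s else 0) ≤ ∑ s, P s * R s e := by
      rw [Finset.sum_mul, ← Finset.sum_sub_distrib]
      refine Finset.sum_le_sum fun s _ => ?_
      by_cases h : Y s e = z
      · have h1 := log_one_add_div_le_tangent he.le (hp0 s) hq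
        have h2 := mul_le_mul_of_nonneg_left h1 (show 0 ≤ 1 + δ by positivity)
        have h3 : R s e = c s + d s * (e z - p s) := Set.indicator_of_mem (show e ∈ Y s ⁻¹' {z} from h) _
        have h4 : (1 + δ) * ((e z - p s) / (q + p s)) = d s * (e z - p s) := by
          simp only [d]
          ring
        rw [if_pos h, ← mul_sub_one, h3]
        refine mul_le_mul_of_nonneg_left ?_ (hP0 s)
        simp only [c]
        linarith
      · have h3 : R s e = 0 := Set.indicator_of_notMem (show e ∉ Y s ⁻¹' {z} from h) _
        rw [if_neg h, h3]
        simp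
    rw [hexp]
    linarith
  have hsumI : Integrable (fun e => ∑ s, P s * R s e) (expProd ζ) :=
    integrable_finsetSum _ fun s _ => (hRI s).const_mul _
  calc _ ≤ ∫ e, (∑ s, P s * R s e + f (e z)) ∂(expProd ζ) :=
        integral_mono_ae hint (hsumI.add hfI') hpt
    _ = ∑ s, P s * (c s * p s) + ∫ e, f (e z) ∂(expProd ζ) := by
        rw [integral_add hsumI hfI', integral_finsetSum _ fun s _ => (hRI s).const_mul _]
        simp_rw [integral_const_mul, hRint]
    _ ≤ ∑ s, P s * (c s * p s) + ∑ s, P s * p s := by gcongr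
    _ = _ := by
        rw [← Finset.sum_add_distrib]
        refine Finset.sum_congr rfl fun s _ => ?_
        simp only [c]
        ring

/-- A finite form of the strong functional representation lemma: a channel `p` is realised by a
random function `u : σ → ζ`, chosen independently of the input, whose output given `u` has mean
entropy at most `I + log (I + 1) + 4`, with `I` the mutual information of input and output. -/
lemma exists_functional_representation [DecidableEq σ] {P : σ → ℝ}
    (hP0 : ∀ s, 0 ≤ P s) (hP1 : ∑ s, P s = 1)
    {p : σ → ζ → ℝ} (hp0 : ∀ s z, 0 ≤ p s z) (hp1 : ∀ s, ∑ z, p s z = 1) {I : ℝ}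
    (hI : I = ∑ s, ∑ z, P s * p s z * log (p s z / ∑ t, P t * p t z)) :
    ∃ κ : (σ → ζ) → ℝ, (∀ u, 0 ≤ κ u) ∧ ∑ u, κ u = 1 ∧
      (∀ s z, (∑ u, if u s = z then κ u else 0) = p s z) ∧
      ∑ u, κ u * ∑ z, negMulLog (∑ s, if u s = z then P s else 0) ≤ I + log (I + 1) + 4 := by
  let : MeasurableSpace ζ := ⊤
  have : MeasurableSingletonClass ζ := ⟨fun _ => trivial⟩
  choose Y hYm hY using fun s => exists_race_winner (hp0 s) (hp1 s)
  let V : (ζ → ℝ) → σ → ζ := fun e s => Y s e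
  have hV : Measurable V := measurable_pi_lambda _ hYm
  let ρ : Measure (σ → ζ) := (expProd ζ).map V
  have : IsProbabilityMeasure ρ := Measure.isProbabilityMeasure_map hV.aemeasurable
  have hVI : ∀ φ : (σ → ζ) → ℝ, Integrable (fun e => φ (V e)) (expProd ζ) := fun φ =>
    (Integrable.of_finite : Integrable φ ρ).comp_measurable hV
  have hVint : ∀ φ : (σ → ζ) → ℝ, ∑ u, ρ.real {u} * φ u = ∫ e, φ (V e) ∂(expProd ζ) := by
    intro φ
    have h := integral_fintype (Integrable.of_finite : Integrable φ ρ)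
    rw [integral_map hV.aemeasurable Integrable.of_finite.aestronglyMeasurable] at h
    exact h.symm
  have hmarg : ∀ s z, (∑ u, if u s = z then ρ.real {u} else 0) = p s z := by
    intro s z
    have h := hVint fun u => if u s = z then 1 else 0
    simp only [mul_ite, mul_one, mul_zero] at h
    rw [h, ← (hY s z).1, ← integral_indicator_one (hYm s (measurableSet_singleton z))]
    refine integral_congr_ae (ae_of_all _ fun e => ?_)
    by_cases he : Y s e = z <;> simp [V, he]
  let q : ζ → ℝ := fun z => ∑ t, P t * p t z
  have hq0 : ∀ z, 0 ≤ q z := fun z => Finset.sum_nonneg fun s _ => mul_nonneg (hP0 s) (hp0 s z)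
  have hqz : ∀ s z, q z = 0 → P s * p s z = 0 := fun s z h =>
    (Finset.sum_eq_zero_iff_of_nonneg fun s _ => mul_nonneg (hP0 s) (hp0 s z)).1 h s
      (Finset.mem_univ s)
  have hq1 : ∑ z, q z = 1 := by
    rw [Finset.sum_comm]
    simp_rw [← Finset.mul_sum, hp1, mul_one, hP1]
  have hPp : ∑ s, ∑ z, P s * p s z = 1 := by simp_rw [← Finset.mul_sum, hp1, mul_one, hP1]
  have hPq : ∑ s, ∑ z, P s * q z = 1 := by simp_rw [← Finset.mul_sum, hq1, mul_one, hP1]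
  have hI0 : 0 ≤ I := by
    rw [hI, ← sub_self (1 : ℝ)]
    nth_rewrite 1 [← hPp]
    rw [← hPq, ← Finset.sum_sub_distrib]
    refine Finset.sum_le_sum fun s _ => ?_
    rw [← Finset.sum_sub_distrib]
    exact Finset.sum_le_sum fun z _ => sub_le_mul_log_div (hP0 s) (hp0 s z) (hq0 z) (hqz s z)
  let δ : ℝ := (I + 1)⁻¹
  have hδ : 0 < δ := by positivity
  have hz : ∀ z, ∑ u, ρ.real {u} * negMulLog (∑ s, if u s = z then P s else 0) ≤
      ∑ s, P s * p s z * ((1 + δ) * log (1 + p s z / q z) - log δ) := by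
    intro z
    rcases (hq0 z).eq_or_lt with h | h
    · have hR : ∑ s, P s * p s z * ((1 + δ) * log (1 + p s z / q z) - log δ) = 0 :=
        Finset.sum_eq_zero fun s _ => by rw [hqz s z h.symm, zero_mul]
      rw [hR]
      refine (Finset.sum_eq_zero fun u _ => ?_).le
      by_cases hu : ρ.real {u} = 0
      · rw [hu, zero_mul]
      have : (∑ s, if u s = z then P s else 0) = 0 := by
        refine Finset.sum_eq_zero fun s _ => ?_
        split_ifs with hus
        · refine (mul_eq_zero.1 (hqz s z h.symm)).resolve_right fun hp => hu ?_
          rw [← hmarg s z] at hp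
          have := (Finset.sum_eq_zero_iff_of_nonneg fun v _ => by split_ifs <;> simp).1 hp u
            (Finset.mem_univ u)
          rwa [if_pos hus] at this
        · rfl
      rw [this, negMulLog_zero, mul_zero]
    · rw [hVint fun u => negMulLog (∑ s, if u s = z then P s else 0)]
      exact integral_negMulLog_race_le hP0 (fun s => hp0 s z) h hYm (fun s => hY s z)
        (hVI fun u => negMulLog (∑ s, if u s = z then P s else 0)) hδ
  refine ⟨fun u => ρ.real {u}, fun u => measureReal_nonneg, ?_, hmarg, ?_⟩
  · simp
  simp_rw [Finset.mul_sum]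
  rw [Finset.sum_comm]
  calc _ ≤ ∑ z, ∑ s, P s * p s z * ((1 + δ) * log (1 + p s z / q z) - log δ) :=
        Finset.sum_le_sum fun z _ => hz z
    _ = ∑ s, ∑ z, P s * p s z * ((1 + δ) * log (1 + p s z / q z) - log δ) := Finset.sum_comm
    _ ≤ ∑ s, ∑ z, ((1 + δ) * (P s * p s z * log (p s z / q z) + P s * q z)
          - P s * p s z * log δ) := by
        refine Finset.sum_le_sum fun s _ => Finset.sum_le_sum fun z _ => ?_
        have := mul_le_mul_of_nonneg_left
          (mul_log_one_add_div_le (hP0 s) (hp0 s z) (hq0 z) (hqz s z)) (show 0 ≤ 1 + δ by positivity)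
        linarith
    _ = (1 + δ) * (I + 1) - log δ := by
        simp only [Finset.sum_sub_distrib]
        simp only [mul_add, Finset.sum_add_distrib]
        rw [hI]
        simp only [mul_assoc (P _), ← Finset.mul_sum, ← Finset.sum_mul, hp1, hq1, mul_one, hP1]
        ring
    _ ≤ _ := by
        have h1 : δ * (I + 1) = 1 := inv_mul_cancel₀ (by positivity)
        have h2 : log δ = -log (I + 1) := log_inv _
        rw [h2]
        linarith

end FunctionalRepresentation

section Entropy

open Real

lemma infH_equiv_comp {Ω α β : Type*} [MeasurableSpace Ω] [Fintype α] [Fintype β]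
    (P : Measure Ω) (X : Ω → α) (e : α ≃ β) : infH P (fun ω => e (X ω)) = infH P X := by
  rw [infH, infH, ← e.sum_comp]
  refine Finset.sum_congr rfl fun a _ => ?_
  congr 3
  ext ω
  simp

lemma infMI_equiv_comp {Ω α β γ : Type*} [MeasurableSpace Ω] [Fintype α] [Fintype β] [Fintype γ]
    (P : Measure Ω) (X : Ω → α) (Y : Ω → γ) (e : α ≃ β) :
    infMI P (fun ω => e (X ω)) Y = infMI P X Y := by
  have := infH_equiv_comp P (fun ω => (X ω, Y ω)) (e.prodCongr (Equiv.refl γ))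
  simp only [Equiv.prodCongr_apply, Prod.map_apply, Equiv.refl_apply] at this
  rw [infMI, infMI, infH_equiv_comp, this]

lemma infH_comp_of_map_eq {Ω Ω' α : Type*} [MeasurableSpace Ω] [MeasurableSpace Ω']
    [Fintype α] [MeasurableSpace α] [MeasurableSingletonClass α] {P : Measure Ω} {μ : Measure Ω'}
    {V : Ω → Ω'} (hV : Measurable V) (hμ : P.map V = μ) {g : Ω' → α} (hg : Measurable g) :
    infH P (fun ω => g (V ω)) = infH μ g := by
  refine Finset.sum_congr rfl fun a _ => ?_
  rw [← hμ, Measure.map_apply hV (hg (measurableSet_singleton a))]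
  rfl

lemma infH_le_card {Ω α : Type*} [MeasurableSpace Ω] [Fintype α] (P : Measure Ω) (X : Ω → α) :
    infH P X ≤ Fintype.card α := by
  refine (Finset.sum_le_card_nsmul _ _ 1 fun a _ => ?_).trans_eq (by simp)
  have h0 : 0 ≤ (P (X ⁻¹' {a})).toReal := ENNReal.toReal_nonneg
  linarith [negMulLog_le_one_sub_self h0]

lemma toReal_measure_preimage_eq_sum {Ω α β : Type*} [MeasurableSpace Ω]
    [Fintype β] [MeasurableSpace β] [MeasurableSingletonClass β] {P : Measure Ω}
    [IsFiniteMeasure P] (X : Ω → α) {Y : Ω → β} (hY : Measurable Y) (a : α) :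
    (P (X ⁻¹' {a})).toReal = ∑ b, (P ((fun ω => (X ω, Y ω)) ⁻¹' {(a, b)})).toReal := by
  have h := measureReal_restrict_apply_univ (μ := P) (X ⁻¹' {a})
  have h2 := sum_measureReal_preimage_singleton (μ := P.restrict (X ⁻¹' {a})) (f := Y) Finset.univ
    fun b _ => hY (measurableSet_singleton b)
  rw [Finset.coe_univ, Set.preimage_univ, h] at h2
  rw [← measureReal_def, ← h2]
  refine Finset.sum_congr rfl fun b _ => ?_
  rw [measureReal_restrict_apply (hY (measurableSet_singleton b)), measureReal_def]
  congr 2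
  ext ω
  simp [and_comm]

lemma infH_le_infH_pair {Ω α β : Type*} [MeasurableSpace Ω] [Fintype α]
    [Fintype β] [MeasurableSpace β] [MeasurableSingletonClass β] {P : Measure Ω}
    [IsFiniteMeasure P] (X : Ω → α) {Y : Ω → β} (hY : Measurable Y) :
    infH P X ≤ infH P (fun ω => (X ω, Y ω)) := by
  rw [infH, infH, Fintype.sum_prod_type]
  refine Finset.sum_le_sum fun a _ => ?_
  have h := toReal_measure_preimage_eq_sum (P := P) X hY a
  set m := (P (X ⁻¹' {a})).toReal
  rw [negMulLog, h, neg_mul, Finset.sum_mul, ← Finset.sum_neg_distrib]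
  refine Finset.sum_le_sum fun b _ => ?_
  set j : β → ℝ := fun b => (P ((fun ω => (X ω, Y ω)) ⁻¹' {(a, b)})).toReal
  have hj : ∀ b, 0 ≤ j b := fun b => ENNReal.toReal_nonneg
  change -(j b * log (∑ b, j b)) ≤ negMulLog (j b)
  rcases (hj b).eq_or_lt with h0 | h0
  · simp [← h0]
  rw [negMulLog, neg_mul, neg_le_neg_iff]
  exact mul_le_mul_of_nonneg_left
    (log_le_log h0 (Finset.single_le_sum (fun b _ => hj b) (Finset.mem_univ b))) h0.le

lemma infMI_le_card {Ω α β : Type*} [MeasurableSpace Ω] [Fintype α]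
    [Fintype β] [MeasurableSpace β] [MeasurableSingletonClass β] {P : Measure Ω}
    [IsFiniteMeasure P] (X : Ω → α) {Y : Ω → β} (hY : Measurable Y) :
    infMI P X Y ≤ Fintype.card β := by
  have := infH_le_infH_pair (P := P) X hY
  have := infH_le_card P Y
  rw [infMI]
  linarith

lemma sum_negMulLog_mul_left {ι : Type*} [Fintype ι] (c : ℝ) (a : ι → ℝ) :
    ∑ i, negMulLog (c * a i) = (∑ i, a i) * negMulLog c + c * ∑ i, negMulLog (a i) := by
  simp_rw [negMulLog_mul, Finset.sum_add_distrib, ← Finset.sum_mul, ← Finset.mul_sum]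

lemma exists_measure_of_weights {Ω : Type*} [Fintype Ω] [DecidableEq Ω] [MeasurableSpace Ω]
    [MeasurableSingletonClass Ω] {w : Ω → ℝ} (hw0 : ∀ ω, 0 ≤ w ω) (hw1 : ∑ ω, w ω = 1) :
    ∃ P : Measure Ω, IsProbabilityMeasure P ∧
      ∀ {α : Type _} [DecidableEq α] (X : Ω → α) (a : α),
        (P (X ⁻¹' {a})).toReal = ∑ ω, if X ω = a then w ω else 0 := by
  let p : PMF Ω := PMF.ofFintype (fun ω => ENNReal.ofReal (w ω)) (by
    rw [← ENNReal.ofReal_sum_of_nonneg fun ω _ => hw0 ω, hw1, ENNReal.ofReal_one])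
  refine ⟨p.toMeasure, inferInstance, fun X a => ?_⟩
  rw [PMF.toMeasure_apply_fintype, ENNReal.toReal_sum fun ω _ => ?_]
  · refine Finset.sum_congr rfl fun ω _ => ?_
    by_cases h : X ω = a
    · rw [if_pos h, Set.indicator_of_mem (show ω ∈ X ⁻¹' {a} from h), PMF.ofFintype_apply,
        ENNReal.toReal_ofReal (hw0 ω)]
    · rw [if_neg h, Set.indicator_of_notMem (show ω ∉ X ⁻¹' {a} from h), ENNReal.toReal_zero]
  · exact ((Set.indicator_le_self _ _ _).trans_lt (p.apply_lt_top ω)).ne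

/-- The input `S` has law `P`, the function `u` has law `κ` independently of `S`, and `Z = u S`.
The variable `U` consists of `u` together with an erased copy of `S`, revealed with
probability `α`. -/
lemma exists_erasure_coupling {σ ζ : Type} [Fintype σ] [MeasurableSpace σ]
    [MeasurableSingletonClass σ] [DecidableEq σ] [Fintype ζ] [MeasurableSpace ζ]
    [MeasurableSingletonClass ζ] [DecidableEq ζ]
    {P : σ → ℝ} (hP0 : ∀ s, 0 ≤ P s) (hP1 : ∑ s, P s = 1)
    {κ : (σ → ζ) → ℝ} (hκ0 : ∀ u, 0 ≤ κ u) (hκ1 : ∑ u, κ u = 1)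
    {α : ℝ} (hα0 : 0 ≤ α) (hα1 : α ≤ 1) :
    ∃ (Ω : Type) (_ : MeasurableSpace Ω) (Q : Measure Ω) (_ : IsProbabilityMeasure Q)
      (Sv : Ω → σ) (Zv : Ω → ζ) (n : ℕ) (U : Ω → Fin n),
      Measurable Sv ∧ Measurable Zv ∧ Measurable U ∧
      (∀ s z, (Q ((fun ω => (Sv ω, Zv ω)) ⁻¹' {(s, z)})).toReal =
        P s * ∑ u, if u s = z then κ u else 0) ∧
      infMI Q U Sv = α * ∑ s, negMulLog (P s) ∧
      infMI Q U Zv = infH Q Zv -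
        (1 - α) * ∑ u, κ u * ∑ z, negMulLog (∑ s, if u s = z then P s else 0) := by
  let w : (σ → ζ) × σ × Bool → ℝ := fun ω =>
    κ ω.1 * (P ω.2.1 * if ω.2.2 then α else 1 - α)
  have hw0 : ∀ ω, 0 ≤ w ω := fun ω => by
    refine mul_nonneg (hκ0 _) (mul_nonneg (hP0 _) ?_)
    split_ifs <;> linarith
  have hw1 : ∑ ω, w ω = 1 := by
    simp [w, Fintype.sum_prod_type, ← Finset.mul_sum, ← mul_add, hP1, hκ1]
  obtain ⟨Q, hQ, hQw⟩ := exists_measure_of_weights hw0 hw1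
  let X : (σ → ζ) × σ × Bool → (σ → ζ) × Option σ := fun ω =>
    (ω.1, if ω.2.2 then some ω.2.1 else none)
  let S : (σ → ζ) × σ × Bool → σ := fun ω => ω.2.1
  let Z : (σ → ζ) × σ × Bool → ζ := fun ω => ω.1 ω.2.1
  have hPα : ∑ t, negMulLog (P t * α) = negMulLog α + α * ∑ t, negMulLog (P t) := by
    simp_rw [mul_comm _ α]
    rw [sum_negMulLog_mul_left, hP1, one_mul]
  have hS : infH Q S = ∑ s, negMulLog (P s) := by
    refine Finset.sum_congr rfl fun s _ => ?_
    rw [hQw]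
    simp [S, w, Fintype.sum_prod_type, ← Finset.sum_mul, hκ1, ← mul_add]
  have hX : infH Q X = ∑ u, negMulLog (κ u) + negMulLog (1 - α) + negMulLog α +
      α * ∑ t, negMulLog (P t) := by
    have h : ∀ u, ∑ o, negMulLog (Q (X ⁻¹' {(u, o)})).toReal =
        negMulLog (κ u) + κ u * (negMulLog (1 - α) + negMulLog α + α * ∑ t, negMulLog (P t)) := by
      intro u
      have h1 : (Q (X ⁻¹' {(u, none)})).toReal = κ u * (1 - α) := by
        rw [hQw]
        simp [X, w, Fintype.sum_prod_type, ite_and, ← Finset.mul_sum, ← Finset.sum_mul, hP1]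
      have h2 : ∀ t, (Q (X ⁻¹' {(u, some t)})).toReal = κ u * (P t * α) := by
        intro t
        rw [hQw]
        simp [X, w, Fintype.sum_prod_type, ite_and]
      rw [Fintype.sum_option, h1]
      simp_rw [h2]
      rw [sum_negMulLog_mul_left, hPα, negMulLog_mul, ← Finset.sum_mul, hP1]
      ring
    rw [infH, Fintype.sum_prod_type]
    simp_rw [h]
    rw [Finset.sum_add_distrib, ← Finset.sum_mul, hκ1]
    ring
  have hXS : infH Q (fun ω => (X ω, S ω)) = ∑ u, negMulLog (κ u) + negMulLog (1 - α) +
      negMulLog α + ∑ t, negMulLog (P t) := by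
    have h : ∀ u, ∑ o, ∑ s, negMulLog (Q ((fun ω => (X ω, S ω)) ⁻¹' {((u, o), s)})).toReal =
        negMulLog (κ u) + κ u * (negMulLog (1 - α) + negMulLog α + ∑ t, negMulLog (P t)) := by
      intro u
      have h1 : ∀ s, (Q ((fun ω => (X ω, S ω)) ⁻¹' {((u, none), s)})).toReal =
          κ u * ((1 - α) * P s) := by
        intro s
        rw [hQw]
        simp [X, S, w, Fintype.sum_prod_type, ite_and, mul_comm (P s)]
      have h2 : ∀ t s, (Q ((fun ω => (X ω, S ω)) ⁻¹' {((u, some t), s)})).toReal =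
          if t = s then κ u * (P t * α) else 0 := by
        intro t s
        rw [hQw]
        simp [X, S, w, Fintype.sum_prod_type, ite_and]
      rw [Fintype.sum_option]
      simp_rw [h1, h2, apply_ite negMulLog, negMulLog_zero, Finset.sum_ite_eq, Finset.mem_univ,
        if_true]
      rw [sum_negMulLog_mul_left, sum_negMulLog_mul_left, sum_negMulLog_mul_left, hPα,
        ← Finset.sum_mul, ← Finset.mul_sum, hP1]
      ring
    rw [infH, Fintype.sum_prod_type, Fintype.sum_prod_type]
    simp_rw [h]
    rw [Finset.sum_add_distrib, ← Finset.sum_mul, hκ1]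
    ring
  have hXZ : infH Q (fun ω => (X ω, Z ω)) = ∑ u, negMulLog (κ u) + negMulLog (1 - α) +
      negMulLog α + α * ∑ t, negMulLog (P t) +
      (1 - α) * ∑ u, κ u * ∑ z, negMulLog (∑ s, if u s = z then P s else 0) := by
    have h : ∀ u, ∑ o, ∑ z, negMulLog (Q ((fun ω => (X ω, Z ω)) ⁻¹' {((u, o), z)})).toReal =
        negMulLog (κ u) + κ u * (negMulLog (1 - α) + negMulLog α + α * ∑ t, negMulLog (P t)) +
        (1 - α) * (κ u * ∑ z, negMulLog (∑ s, if u s = z then P s else 0)) := by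
      intro u
      have h1 : ∀ z, (Q ((fun ω => (X ω, Z ω)) ⁻¹' {((u, none), z)})).toReal =
          κ u * ((1 - α) * ∑ s, if u s = z then P s else 0) := by
        intro z
        rw [hQw]
        simp [X, Z, w, Fintype.sum_prod_type, ite_and, Finset.mul_sum]
        refine Finset.sum_congr rfl fun s _ => ?_
        split_ifs <;> ring
      have h2 : ∀ t z, (Q ((fun ω => (X ω, Z ω)) ⁻¹' {((u, some t), z)})).toReal =
          if u t = z then κ u * (P t * α) else 0 := by
        intro t z
        rw [hQw]
        simp [X, Z, w, Fintype.sum_prod_type, ite_and]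
      have h3 : ∑ z, ∑ s, (if u s = z then P s else 0) = 1 := by
        rw [Finset.sum_comm]
        simp [hP1]
      rw [Fintype.sum_option]
      simp_rw [h1, h2, apply_ite negMulLog, negMulLog_zero, Finset.sum_ite_eq, Finset.mem_univ,
        if_true]
      rw [sum_negMulLog_mul_left, sum_negMulLog_mul_left, sum_negMulLog_mul_left, hPα,
        ← Finset.sum_mul, ← Finset.mul_sum, hP1, h3]
      ring
    rw [infH, Fintype.sum_prod_type, Fintype.sum_prod_type]
    simp_rw [h]
    rw [Finset.sum_add_distrib, Finset.sum_add_distrib, ← Finset.sum_mul, ← Finset.mul_sum, hκ1]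
    ring
  refine ⟨_, inferInstance, Q, hQ, S, Z, _, fun ω => Fintype.equivFin _ (X ω),
    Measurable.of_discrete, Measurable.of_discrete, Measurable.of_discrete, fun s z => ?_, ?_, ?_⟩
  · rw [hQw]
    simp only [S, Z, w, Fintype.sum_prod_type, Prod.mk.injEq, ite_and, Fintype.sum_bool, if_true,
      Bool.false_eq_true, if_false, Finset.mul_sum]
    refine Finset.sum_congr rfl fun u _ => ?_
    rw [Finset.sum_eq_single s (fun t _ h => by simp [h]) (by simp)]
    simp only [if_true]
    split_ifs <;> ring
  · rw [infMI_equiv_comp, infMI, hX, hS, hXS]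
    ring
  · rw [infMI_equiv_comp, infMI, hX, hXZ]
    ring

end Entropy

lemma infMI_eq_sum_mul_log {σ ζ : Type*} [Fintype σ] [Fintype ζ] [MeasurableSpace σ]
    [MeasurableSpace ζ] [MeasurableSingletonClass σ] [MeasurableSingletonClass ζ]
    (μ : Measure (σ × ζ)) [IsFiniteMeasure μ] {P : σ → ℝ} {p : σ → ζ → ℝ}
    (hP : ∀ s, (μ (Prod.fst ⁻¹' {s})).toReal = P s)
    (hPp : ∀ s z, (μ {(s, z)}).toReal = P s * p s z) :
    infMI μ Prod.fst Prod.snd =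
      ∑ s, ∑ z, P s * p s z * Real.log (p s z / ∑ t, P t * p t z) := by
  have hid : ∀ x : σ × ζ, (fun ω : σ × ζ => (ω.1, ω.2)) ⁻¹' {x} = {x} := fun x => by ext; simp
  have hPs : ∀ s, P s = ∑ z, P s * p s z := fun s => by
    refine (hP s).symm.trans ?_
    rw [toReal_measure_preimage_eq_sum Prod.fst measurable_snd]
    simp_rw [hid, hPp]
  have hZ : ∀ z, (μ (Prod.snd ⁻¹' {z})).toReal = ∑ s, P s * p s z := fun z => by
    rw [toReal_measure_preimage_eq_sum Prod.snd measurable_fst]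
    refine Finset.sum_congr rfl fun s _ => ?_
    rw [← hPp]
    congr 2
    ext ω
    simp [Prod.ext_iff, and_comm]
  have hnn : ∀ s z, 0 ≤ P s * p s z := fun s z => hPp s z ▸ ENNReal.toReal_nonneg
  have h1 : infH μ Prod.fst = ∑ s, ∑ z, -(P s * p s z * Real.log (P s)) := by
    refine Finset.sum_congr rfl fun s _ => ?_
    rw [hP, Finset.sum_neg_distrib, ← Finset.sum_mul, ← hPs, Real.negMulLog, neg_mul]
  have h2 : infH μ Prod.snd = ∑ s, ∑ z, -(P s * p s z * Real.log (∑ t, P t * p t z)) := by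
    rw [Finset.sum_comm]
    refine Finset.sum_congr rfl fun z _ => ?_
    rw [hZ, Finset.sum_neg_distrib, ← Finset.sum_mul, Real.negMulLog, neg_mul]
  have h3 : infH μ (fun ω : σ × ζ => (ω.1, ω.2)) =
      ∑ s, ∑ z, -(P s * p s z * Real.log (P s * p s z)) := by
    rw [infH, Fintype.sum_prod_type]
    refine Finset.sum_congr rfl fun s _ => Finset.sum_congr rfl fun z _ => ?_
    rw [hid, hPp, Real.negMulLog, neg_mul]
  rw [infMI, h1, h2, h3]
  simp_rw [← Finset.sum_add_distrib, ← Finset.sum_sub_distrib]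
  refine Finset.sum_congr rfl fun s _ => Finset.sum_congr rfl fun z _ => ?_
  rcases eq_or_ne (P s * p s z) 0 with h | h
  · simp [h]
  have hq : (∑ t, P t * p t z) ≠ 0 := fun h' =>
    h ((Finset.sum_eq_zero_iff_of_nonneg fun t _ => hnn t z).1 h' s (Finset.mem_univ s))
  rw [Real.log_mul (left_ne_zero_of_mul h) (right_ne_zero_of_mul h),
    Real.log_div (right_ne_zero_of_mul h) hq]
  ring

/-- The regular conditional probabilities of a finite joint law. -/
lemma exists_channel {σ ζ : Type*} [Fintype σ] [Fintype ζ] [MeasurableSpace σ]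
    [MeasurableSpace ζ] [MeasurableSingletonClass σ] [MeasurableSingletonClass ζ]
    (μ : Measure (σ × ζ)) [IsProbabilityMeasure μ] :
    ∃ p : σ → ζ → ℝ, (∀ s z, 0 ≤ p s z) ∧ (∀ s, ∑ z, p s z = 1) ∧
      ∀ s z, (μ {(s, z)}).toReal = (μ (Prod.fst ⁻¹' {s})).toReal * p s z := by
  have hs : ∀ s, ∑ z, (μ {(s, z)}).toReal = (μ (Prod.fst ⁻¹' {s})).toReal := fun s => by
    rw [toReal_measure_preimage_eq_sum Prod.fst measurable_snd]
    refine Finset.sum_congr rfl fun z _ => ?_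
    congr 2
  refine ⟨fun s z => if (μ (Prod.fst ⁻¹' {s})).toReal = 0 then (μ (Prod.snd ⁻¹' {z})).toReal
    else (μ {(s, z)}).toReal / (μ (Prod.fst ⁻¹' {s})).toReal, fun s z => ?_, fun s => ?_,
    fun s z => ?_⟩
  · dsimp only
    split_ifs <;> positivity
  · by_cases h : (μ (Prod.fst ⁻¹' {s})).toReal = 0
    · simp_rw [if_pos h]
      have := sum_measureReal_preimage_singleton (μ := μ) (f := Prod.snd) Finset.univ
        fun z _ => measurable_snd (measurableSet_singleton z)
      simpa [measureReal_def] using this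
    · simp_rw [if_neg h]
      rw [← Finset.sum_div, hs, div_self h]
  · dsimp only
    split_ifs with h
    · rw [h, zero_mul]
      exact (Finset.sum_eq_zero_iff_of_nonneg fun z _ => ENNReal.toReal_nonneg).1
        ((hs s).trans h) z (Finset.mem_univ z)
    · rw [mul_div_cancel₀ _ h]

/-- **second lower bound of Theorem 1.** Let `S` and `Z` have joint distribution
`μ = P_{S,Z}`, `H(S) > 0`, `0 ≤ ε ≤ H(S)` and `α = ε / H(S)`.  Then there exists `U` (on a
probability space carrying a copy of `(S,Z)`) with `I(U;S) = ε` and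
`I(U;Z) ≥ H(Z|S) − α·H(S|Z) + ε − (1−α)·(log(I(S;Z)+1) + 4)`.
In particular `h_ε(P_{S,Z}) ≥ L_h^2(ε)`. -/
theorem second_lower_bound_tradeoff
    {σ ζ : Type} [Fintype σ] [MeasurableSpace σ] [MeasurableSingletonClass σ]
    [Fintype ζ] [MeasurableSpace ζ] [MeasurableSingletonClass ζ]
    (μ : Measure (σ × ζ)) [IsProbabilityMeasure μ]
    (hHS : 0 < infH μ Prod.fst)
    {ε : ℝ} (hε : 0 ≤ ε) (hεH : ε ≤ infH μ Prod.fst) :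
    (∃ (Ω : Type) (_ : MeasurableSpace Ω) (P : Measure Ω) (_ : IsProbabilityMeasure P)
      (Sv : Ω → σ) (Zv : Ω → ζ) (n : ℕ) (U : Ω → Fin n),
      Measurable Sv ∧ Measurable Zv ∧ Measurable U ∧
      P.map (fun ω => (Sv ω, Zv ω)) = μ ∧
      infMI P U Sv = ε ∧
      infMI P U Zv ≥
        infCondH μ Prod.snd Prod.fst
          - (ε / infH μ Prod.fst) * infCondH μ Prod.fst Prod.snd + ε
          - (1 - ε / infH μ Prod.fst)
            * (Real.log (infMI μ Prod.fst Prod.snd + 1) + 4)) ∧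
    hEps μ ε ≥
      infCondH μ Prod.snd Prod.fst
        - (ε / infH μ Prod.fst) * infCondH μ Prod.fst Prod.snd + ε
        - (1 - ε / infH μ Prod.fst)
          * (Real.log (infMI μ Prod.fst Prod.snd + 1) + 4) := by
  classical
  set H := infH μ Prod.fst
  set I := infMI μ Prod.fst Prod.snd
  set P : σ → ℝ := fun s => (μ (Prod.fst ⁻¹' {s})).toReal
  have hP0 : ∀ s, 0 ≤ P s := fun s => ENNReal.toReal_nonneg
  have hP1 : ∑ s, P s = 1 := by
    have := sum_measureReal_preimage_singleton (μ := μ) (f := Prod.fst) Finset.univ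
      fun s _ => measurable_fst (measurableSet_singleton s)
    simpa [measureReal_def] using this
  obtain ⟨p, hp0, hp1, hPp⟩ := exists_channel μ
  obtain ⟨κ, hκ0, hκ1, hκ, hent⟩ := exists_functional_representation hP0 hP1 hp0 hp1
    (infMI_eq_sum_mul_log μ (fun _ => rfl) hPp)
  have hα0 : 0 ≤ ε / H := div_nonneg hε hHS.le
  have hα1 : ε / H ≤ 1 := (div_le_one hHS).2 hεH
  have hαH : ε / H * H = ε := div_mul_cancel₀ _ hHS.ne'
  obtain ⟨Ω, mΩ, Q, hQ, S, Z, n, U, hS, hZ, hU, hSZ, hUS, hUZ⟩ :=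
    exists_erasure_coupling hP0 hP1 hκ0 hκ1 hα0 hα1
  have hmap : Q.map (fun ω => (S ω, Z ω)) = μ := by
    have : IsProbabilityMeasure (Q.map fun ω => (S ω, Z ω)) :=
      Measure.isProbabilityMeasure_map (hS.prodMk hZ).aemeasurable
    refine Measure.ext_of_singleton fun x => ?_
    rw [← ENNReal.toReal_eq_toReal_iff' (measure_ne_top _ _) (measure_ne_top _ _),
      Measure.map_apply (hS.prodMk hZ) (measurableSet_singleton x), hSZ, hκ, hPp]
  have hHZ : infH Q Z = infH μ Prod.snd :=
    infH_comp_of_map_eq (hS.prodMk hZ) hmap measurable_snd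
  have hleak : infMI Q U S = ε := hUS.trans hαH
  have hswap : infH μ (fun ω : σ × ζ => (ω.2, ω.1)) = infH μ fun ω : σ × ζ => (ω.1, ω.2) :=
    infH_equiv_comp μ (fun ω : σ × ζ => (ω.1, ω.2)) (Equiv.prodComm σ ζ)
  have hbound : infCondH μ Prod.snd Prod.fst - ε / H * infCondH μ Prod.fst Prod.snd + ε
      - (1 - ε / H) * (Real.log (I + 1) + 4) ≤ infMI Q U Z := by
    have h := mul_le_mul_of_nonneg_left hent (sub_nonneg.2 hα1)
    have hI : I = H + infH μ Prod.snd - infH μ fun ω : σ × ζ => (ω.1, ω.2) := rfl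
    rw [hUZ, hHZ, infCondH, infCondH, hswap]
    generalize ε / H = α at *
    have : infH μ (fun ω : σ × ζ => (ω.1, ω.2)) = H + infH μ Prod.snd - I := by linarith
    rw [this, ← hαH]
    linarith
  refine ⟨⟨Ω, mΩ, Q, hQ, S, Z, n, U, hS, hZ, hU, hmap, hleak, hbound⟩, hbound.trans ?_⟩
  refine le_csSup ⟨Fintype.card ζ, ?_⟩
    ⟨Ω, mΩ, Q, hQ, S, Z, n, U, hS, hZ, hU, hmap, hleak.le, rfl⟩
  rintro _ ⟨_, _, _, _, _, Z', _, U', _, hZ', _, _, _, rfl⟩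
  exact infMI_le_card U' hZ'
end

section
/- Let S, Z, W, U be random variables taking values in finite alphabets on a common probability space, where Z plays the role of the semantic f(X) and W the role of the task h(X). If I(U;S) ≤ ε, then the utility attained by the user satisfies I(U;W) ≤ H(Z|S) + ε + H(W|Z). (Upper bound on utility in Theorem 1.) -/
open MeasureTheory ProbabilityTheory

theorem sum_measureReal_preimage_prod {Ω α β : Type*} [MeasurableSpace Ω] (P : Measure Ω)
    [IsFiniteMeasure P] [Fintype α] [MeasurableSpace α] [MeasurableSingletonClass α]
    [MeasurableSpace β] [MeasurableSingletonClass β]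
    {X : Ω → α} {Y : Ω → β} (hX : Measurable X) (hY : Measurable Y) (b : β) :
    ∑ a, P.real ((fun ω => (X ω, Y ω)) ⁻¹' {(a, b)}) = P.real (Y ⁻¹' {b}) := by
  rw [← measureReal_biUnion_finset]
  · congr 1
    ext ω
    simp
  · intro a _ a' _ h
    refine Set.disjoint_left.2 fun ω h₁ h₂ => h ?_
    simp only [Set.mem_preimage, Set.mem_singleton_iff, Prod.mk.injEq] at h₁ h₂
    exact h₁.1.symm.trans h₂.1
  · exact fun a _ => (hX.prodMk hY) (measurableSet_singleton _)

theorem sum_measureReal_preimage_singleton_eq_one {Ω α : Type*} [MeasurableSpace Ω] (P : Measure Ω)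
    [IsProbabilityMeasure P] [Fintype α] [MeasurableSpace α] [MeasurableSingletonClass α]
    {X : Ω → α} (hX : Measurable X) :
    ∑ a, P.real (X ⁻¹' {a}) = 1 := by
  rw [sum_measureReal_preimage_singleton _
    fun a _ => hX (measurableSet_singleton a)]
  simp

/-- The entropy of a function `f T` of `T` as an average over the values of `T`. -/
theorem infH_comp {Ω α β : Type*} [MeasurableSpace Ω] (P : Measure Ω) [IsFiniteMeasure P]
    [Fintype α] [Fintype β] [MeasurableSpace β] [MeasurableSingletonClass β]
    {T : Ω → β} (hT : Measurable T) (f : β → α) :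
    infH P (fun ω => f (T ω)) =
      ∑ t, -(P.real (T ⁻¹' {t}) * Real.log (P.real ((fun ω => f (T ω)) ⁻¹' {f t}))) := by
  classical
  rw [infH, ← Finset.sum_fiberwise (s := Finset.univ) (g := f)]
  refine Finset.sum_congr rfl fun a _ => ?_
  have hfib : P.real ((fun ω => f (T ω)) ⁻¹' {a}) =
      ∑ t with f t = a, P.real (T ⁻¹' {t}) := by
    rw [sum_measureReal_preimage_singleton _
      fun t _ => hT (measurableSet_singleton t)]
    congr 1
    ext ω
    simp
  calc Real.negMulLog (P.real ((fun ω => f (T ω)) ⁻¹' {a}))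
      = -((∑ t with f t = a, P.real (T ⁻¹' {t})) *
          Real.log (P.real ((fun ω => f (T ω)) ⁻¹' {a}))) := by
        rw [Real.negMulLog, ← hfib, neg_mul]
    _ = _ := by
        rw [Finset.sum_mul, ← Finset.sum_neg_distrib]
        refine Finset.sum_congr rfl fun t ht => ?_
        rw [(Finset.mem_filter.1 ht).2]

theorem sub_mul_div_le_mul_log {q a b c d : ℝ} (hq : 0 ≤ q) (ha : q ≤ a) (hb : q ≤ b)
    (hc : q ≤ c) (hd : q ≤ d) :
    q - c * d / a ≤ q * (Real.log a + Real.log b - Real.log c - Real.log d) := by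
  rcases hq.eq_or_lt with rfl | hq
  · have : 0 ≤ c * d / a := by positivity
    linarith
  have ha' := hq.trans_le ha
  have hb' := hq.trans_le hb
  have hc' := hq.trans_le hc
  have hd' := hq.trans_le hd
  have hlog : Real.log c + Real.log d - Real.log a - Real.log b ≤ c * d / (a * b) - 1 := by
    have h := Real.log_le_sub_one_of_pos (show 0 < c * d / (a * b) by positivity)
    rw [Real.log_div (by positivity) (by positivity), Real.log_mul hc'.ne' hd'.ne',
      Real.log_mul ha'.ne' hb'.ne'] at h
    linarith
  have hratio : q * (c * d / (a * b)) ≤ c * d / a := by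
    calc q * (c * d / (a * b)) ≤ b * (c * d / (a * b)) := by gcongr
      _ = c * d / a := by field_simp
  nlinarith [mul_le_mul_of_nonneg_left hlog hq.le]

theorem infMI_le_infMI_add_infCondH {Ω α β γ : Type*} [MeasurableSpace Ω] (P : Measure Ω)
    [IsProbabilityMeasure P]
    [Fintype α] [MeasurableSpace α] [MeasurableSingletonClass α]
    [Fintype β] [MeasurableSpace β] [MeasurableSingletonClass β]
    [Fintype γ] [MeasurableSpace γ] [MeasurableSingletonClass γ]
    {U : Ω → α} {W : Ω → β} {Z : Ω → γ}
    (hU : Measurable U) (hW : Measurable W) (hZ : Measurable Z) :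
    infMI P U W ≤ infMI P U Z + infCondH P W Z := by
  have hT : Measurable fun ω => (W ω, U ω, Z ω) := hW.prodMk (hU.prodMk hZ)
  have eW := infH_comp P hT fun t => t.1
  have eUZ := infH_comp P hT fun t => (t.2.1, t.2.2)
  have eUW := infH_comp P hT fun t => (t.2.1, t.1)
  have eWZ := infH_comp P hT fun t => (t.1, t.2.2)
  have hsum : ∑ t : β × α × γ,
      P.real ((fun ω => (U ω, W ω)) ⁻¹' {(t.2.1, t.1)}) *
        P.real ((fun ω => (W ω, Z ω)) ⁻¹' {(t.1, t.2.2)}) / P.real (W ⁻¹' {t.1}) = 1 := by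
    have hswap (w : β) : ∑ z, P.real ((fun ω => (W ω, Z ω)) ⁻¹' {(w, z)}) =
        P.real (W ⁻¹' {w}) := by
      rw [← sum_measureReal_preimage_prod P hZ hW w]
      refine Finset.sum_congr rfl fun z _ => congrArg P.real ?_
      ext ω
      simp [and_comm]
    simp_rw [Fintype.sum_prod_type, ← Finset.sum_div, ← Finset.mul_sum, hswap,
      ← Finset.sum_mul, sum_measureReal_preimage_prod P hU hW, mul_self_div_self]
    exact sum_measureReal_preimage_singleton_eq_one P hW
  have hle : ∑ t : β × α × γ, (P.real ((fun ω => (W ω, U ω, Z ω)) ⁻¹' {t}) -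
      P.real ((fun ω => (U ω, W ω)) ⁻¹' {(t.2.1, t.1)}) *
        P.real ((fun ω => (W ω, Z ω)) ⁻¹' {(t.1, t.2.2)}) / P.real (W ⁻¹' {t.1})) ≤
      infH P (fun ω => (U ω, W ω)) + infH P (fun ω => (W ω, Z ω)) -
        infH P W - infH P (fun ω => (U ω, Z ω)) := by
    rw [eW, eUZ, eUW, eWZ, ← Finset.sum_add_distrib, ← Finset.sum_sub_distrib,
      ← Finset.sum_sub_distrib]
    refine Finset.sum_le_sum fun t _ => ?_
    have key := sub_mul_div_le_mul_log
      (q := P.real ((fun ω => (W ω, U ω, Z ω)) ⁻¹' {t}))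
      (a := P.real (W ⁻¹' {t.1}))
      (b := P.real ((fun ω => (U ω, Z ω)) ⁻¹' {(t.2.1, t.2.2)}))
      (c := P.real ((fun ω => (U ω, W ω)) ⁻¹' {(t.2.1, t.1)}))
      (d := P.real ((fun ω => (W ω, Z ω)) ⁻¹' {(t.1, t.2.2)}))
      measureReal_nonneg
      (measureReal_mono (by rintro ω rfl; rfl)) (measureReal_mono (by rintro ω rfl; rfl))
      (measureReal_mono (by rintro ω rfl; rfl)) (measureReal_mono (by rintro ω rfl; rfl))
    linarith
  rw [Finset.sum_sub_distrib, hsum, sum_measureReal_preimage_singleton_eq_one P hT] at hle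
  simp only [infMI, infCondH]
  linarith

/-- **upper bound on utility in Theorem 1.** For random variables
`S, Z, W, U` on a common probability space (with `Z` the semantic and `W` the task), if
`I(U;S) ≤ ε` then `I(U;W) ≤ H(Z|S) + ε + H(W|Z)`. -/
theorem utility_upper_bound
    {Ω : Type} [MeasurableSpace Ω] (P : Measure Ω) [IsProbabilityMeasure P]
    {σ ζ τ υ : Type} [Fintype σ] [MeasurableSpace σ] [MeasurableSingletonClass σ]
    [Fintype ζ] [MeasurableSpace ζ] [MeasurableSingletonClass ζ]
    [Fintype τ] [MeasurableSpace τ] [MeasurableSingletonClass τ]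
    [Fintype υ] [MeasurableSpace υ] [MeasurableSingletonClass υ]
    (S : Ω → σ) (Z : Ω → ζ) (W : Ω → τ) (U : Ω → υ)
    (hS : Measurable S) (hZ : Measurable Z) (hW : Measurable W) (hU : Measurable U)
    {ε : ℝ} (hleak : infMI P U S ≤ ε) :
    infMI P U W ≤ infCondH P Z S + ε + infCondH P W Z := by
  have hUW := infMI_le_infMI_add_infCondH P hU hW hZ
  have hUZ := infMI_le_infMI_add_infCondH P hU hZ hS
  linarith
end
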